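/- Let O be a W-orbit in ℝ^r, and let q^{1/2}, k_0, u_0, k, k_r, u_r ∈ F^× and t ∈ T_O. The operators T_0^O, T_1^O, …, T_r^O on F[O] satisfy the braid relations of the affine Coxeter system of type C_r — T_i^O T_{i+1}^O T_i^O = T_{i+1}^O T_i^O T_{i+1}^O for 1 ≤ i ≤ r−2, T_{r−1}^O T_r^O T_{r−1}^O T_r^O = T_r^O T_{r−1}^O T_r^O T_{r−1}^O, T_i^O T_{i'}^O = T_{i'}^O T_i^O for 1 ≤ i, i' ≤ r with |i − i'| > 1, T_0^O T_1^O T_0^O T_1^O = T_1^O T_0^O T_1^O T_0^O, and T_0^O T_i^O = T_i^O T_0^O for 1 < i ≤ r — as well as the Hecke relations (T_0^O − k_0)∘(T_0^O + k_0^{−1}) = 0, (T_i^O − k)∘(T_i^O + k^{−1}) = 0 for 1 ≤ i < r, and (T_r^O − k_r)∘(T_r^O + k_r^{−1}) = 0. -/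

import Mathlib

open scoped Classical

noncomputable section

namespace QP

/-! ### The space of quasi-polynomials -/

/-- Euclidean space `ℝ^r`. -/
abbrev E (r : ℕ) := Fin r → ℝ

variable (F : Type*) [Field F] [CharZero F] (r : ℕ)

/-- The algebra of quasi-polynomials `F[ℝ^r]`: the group algebra of `(ℝ^r,+)` over `F`. -/
abbrev QA := AddMonoidAlgebra F (E r)

/-- The quasi-monomial `x^y`. -/
def X (y : E r) : QA F r := AddMonoidAlgebra.single y 1

/-- The `i`-th coordinate of a vector (`1`-based). -/
def cd (y : E r) (i : ℕ) : ℝ := ∑ m : Fin r, if (m : ℕ) + 1 = i then y m else 0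

/-- The standard basis vector `ε_i` (`1`-based). -/
def epsV (i : ℕ) : E r := fun m => if (m : ℕ) + 1 = i then 1 else 0

/-- The standard basis vector (`0`-based). -/
def eV (m : Fin r) : E r := fun n => if n = m then 1 else 0

/-- The Euclidean inner product on `ℝ^r`. -/
def ip (v y : E r) : ℝ := ∑ m : Fin r, v m * y m

/-- An integral vector regarded as an element of `ℝ^r`. -/
def zc (lam : Fin r → ℤ) : E r := fun m => (lam m : ℝ)

/-- The simple reflections of the hyperoctahedral group `W₀ = S_r ⋉ (±1)^r` (`1`-based):
for `1 ≤ i < r`, `sW i` interchanges the `i`-th and `(i+1)`-st coordinates, and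
`sW r` negates the last coordinate. -/
def sW (i : ℕ) (y : E r) : E r := fun m =>
  if i = r then (if (m : ℕ) + 1 = r then -y m else y m)
  else if (m : ℕ) + 1 = i then cd r y (i + 1)
  else if (m : ℕ) = i then cd r y i
  else y m

/-- `s_{ε₁} = s₁⋯s_{r-1} s_r s_{r-1}⋯s₁`: negation of the first coordinate. -/
def sEps1 (y : E r) : E r := fun m => if (m : ℕ) = 0 then -y m else y m

/-- The affine simple reflection `s₀ = τ(ε₁) s_{ε₁} : y ↦ (1 - y₁, y₂, …, y_r)`, together
with `genF j = sW j` for `1 ≤ j ≤ r`: the Coxeter generators of the affine Weyl group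
`W = W₀ ⋉ ℤ^r`. -/
def genF (j : ℕ) (y : E r) : E r :=
  if j = 0 then fun m => if (m : ℕ) = 0 then 1 - y m else y m
  else sW r j y

/-- The action of the word `s_{j₁} ⋯ s_{j_ℓ}` on `ℝ^r`. -/
def wordAct (l : List ℕ) (y : E r) : E r := l.foldr (genF r) y

/-- The closure of the fundamental alcove
`C₊ = {y : 0 < y_r < ⋯ < y₁ < 1/2}`. -/
def CplusCl : Set (E r) :=
  {y | (∀ i j : Fin r, i ≤ j → y j ≤ y i) ∧ ∀ m : Fin r, 0 ≤ y m ∧ y m ≤ 1 / 2}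

/-- The `W`-orbit of a point of `ℝ^r`. -/
def orbit (y : E r) : Set (E r) :=
  {z | ∃ l : List ℕ, (∀ a ∈ l, a ≤ r) ∧ wordAct r l y = z}

/-- `O` is a `W`-orbit in `ℝ^r`. -/
def IsOrbit (O : Set (E r)) : Prop := ∃ y, O = orbit r y

/-- `c^𝒪`: the unique point of the orbit `O` lying in the closed fundamental alcove. -/
def cpt (O : Set (E r)) : E r :=
  if h : ∃ c, c ∈ O ∧ c ∈ CplusCl r then h.choose else 0

/-- The length of an element of the affine Weyl group `W` (as a map on `ℝ^r`). -/
def wlen (g : E r → E r) : ℕ :=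
  sInf {n | ∃ l : List ℕ, (∀ a ∈ l, a ≤ r) ∧ l.length = n ∧ (fun y => wordAct r l y) = g}

/-- A choice of a shortest word `l` whose inverse maps `y` into the closed alcove;
the corresponding element of `W` is `g_y`. -/
def gW (y : E r) : List ℕ :=
  if h : ∃ l : List ℕ, (∀ a ∈ l, a ≤ r) ∧ wordAct r l.reverse y ∈ CplusCl r ∧
      ∀ l' : List ℕ, (∀ a ∈ l', a ≤ r) → wordAct r l'.reverse y ∈ CplusCl r →
        l.length ≤ l'.length
  then h.choose else []

/-- `g_y`, the unique shortest element of `W` with `g_y⁻¹ y` in the closed alcove. -/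
def gfun (y : E r) : E r → E r := fun z => wordAct r (gW r y) z

/-- The Bruhat order on `(W, {s₀,…,s_r})`, via the subword characterisation. -/
def bruhatLE (u v : E r → E r) : Prop :=
  ∃ l : List ℕ, (∀ a ∈ l, a ≤ r) ∧ (fun z => wordAct r l z) = v ∧ l.length = wlen r v ∧
    ∃ l' : List ℕ, l'.Sublist l ∧ (fun z => wordAct r l' z) = u ∧ l'.length = wlen r u

/-- The partial order on `ℝ^r`: `y' ≤ y` iff `y'` and `y` lie in the same `W`-orbit and
`g_{y'} ≤_B g_y` in the Bruhat order. -/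
def qle (y' y : E r) : Prop :=
  (∃ l : List ℕ, (∀ a ∈ l, a ≤ r) ∧ wordAct r l y = y') ∧ bruhatLE r (gfun r y') (gfun r y)

/-- Strict version of `qle`. -/
def qlt (y' y : E r) : Prop := qle r y' y ∧ y' ≠ y

/-- The `F`-linear operator on `F[ℝ^r]` determined by its values on the quasi-monomials. -/
def mkOp (Ψ : E r → QA F r) : Module.End F (QA F r) :=
  Finsupp.linearCombination F Ψ ∘ₗ (AddMonoidAlgebra.coeffLinearEquiv F).toLinearMap

/-- `F[O] = span_F {x^y : y ∈ O}`. -/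
def FO (O : Set (E r)) : Submodule F (QA F r) :=
  Submodule.span F {p | ∃ y ∈ O, p = X F r y}

/-- The Laurent polynomial subalgebra `F[ℤ^r] = span_F {x^μ : μ ∈ ℤ^r}`. -/
def Lspan : Submodule F (QA F r) :=
  Submodule.span F {p | ∃ lam : Fin r → ℤ, p = X F r (zc r lam)}

/-- `span_F {x^{y'} : y' < y}`. -/
def ltSpan (y : E r) : Submodule F (QA F r) :=
  Submodule.span F {p | ∃ y', qlt r y' y ∧ p = X F r y'}

/-! ### Floors and indicator/sign functions -/

/-- the largest even integer `≤ z` -/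
def floorE (z : ℝ) : ℤ := 2 * ⌊z / 2⌋
/-- the largest odd integer `≤ z` -/
def floorO (z : ℝ) : ℤ := 2 * ⌊(z + 1) / 2⌋ - 1
/-- indicator of `ℤ ⊆ ℝ` -/
def chiZ (z : ℝ) : ℕ := if ∃ n : ℤ, z = n then 1 else 0
/-- indicator of the even integers -/
def chiE (z : ℝ) : ℕ := if ∃ n : ℤ, z = 2 * n then 1 else 0
/-- indicator of the odd integers -/
def chiO (z : ℝ) : ℕ := if ∃ n : ℤ, z = 2 * n + 1 then 1 else 0
/-- `η_e`: `1` on even integers `≥ 2`, `-1` on even integers `≤ 0`, `0` otherwise -/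
def etaE (z : ℝ) : ℤ := if ∃ n : ℤ, z = 2 * n then (if 2 ≤ z then 1 else -1) else 0
/-- `η_o`: `1` on odd integers `≥ 1`, `-1` on odd integers `≤ -1`, `0` otherwise -/
def etaO (z : ℝ) : ℤ := if ∃ n : ℤ, z = 2 * n + 1 then (if 1 ≤ z then 1 else -1) else 0
/-- `η = η_e + η_o` -/
def eta (z : ℝ) : ℤ := etaE z + etaO z

/-- `geomS c v m` is the truncated geometric series `(1 - (c·x^v)^m)/(1 - c·x^v)`,
a genuine element of `F[ℝ^r]`; it is the unique element with
`(1 - c·x^v) * geomS c v m = 1 - c^m·x^{m v}`. -/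
def geomS (c : F) (v : E r) (m : ℤ) : QA F r :=
  if 0 ≤ m then ∑ t ∈ Finset.range m.toNat, c ^ (t : ℤ) • X F r ((t : ℝ) • v)
  else -∑ t ∈ Finset.range (-m).toNat, c ^ (-(t : ℤ) - 1) • X F r ((-(t : ℝ) - 1) • v)

/-! ### Truncated divided difference operators and Demazure–Lusztig operators -/

/-- `∇_i(x^y) = ((1 - (x_{i+1}/x_i)^{⌊y_i - y_{i+1}⌋})/(1 - x_i/x_{i+1}))·x^y`. -/
def nablaIel (i : ℕ) (y : E r) : QA F r :=
  geomS F r 1 (epsV r i - epsV r (i + 1)) (-⌊cd r y i - cd r y (i + 1)⌋) * X F r y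

/-- `∇_r^e(x^y) = ((1 - x_r^{-⌊2y_r⌋_e})/(1 - x_r^2))·x^y`. -/
def nablaReEl (y : E r) : QA F r :=
  geomS F r 1 ((2 : ℝ) • epsV r r) (-floorE (2 * cd r y r) / 2) * X F r y

/-- `∇_r^o(x^y) = ((x_r - x_r^{-⌊2y_r⌋_o})/(1 - x_r^2))·x^y`. -/
def nablaRoEl (y : E r) : QA F r :=
  X F r (epsV r r) *
    geomS F r 1 ((2 : ℝ) • epsV r r) ((-floorO (2 * cd r y r) - 1) / 2) * X F r y

def nablaIop (i : ℕ) : Module.End F (QA F r) := mkOp F r (nablaIel F r i)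
def nablaReOp : Module.End F (QA F r) := mkOp F r (nablaReEl F r)
def nablaRoOp : Module.End F (QA F r) := mkOp F r (nablaRoEl F r)

/-- The value of the truncated Demazure–Lusztig operator `T_i` (`1 ≤ i ≤ r`) on `x^y`. -/
def Tel (k kr ur : F) (i : ℕ) (y : E r) : QA F r :=
  if i = r then
    (kr ^ chiE (2 * cd r y r) * ur ^ chiO (2 * cd r y r)) • X F r (sW r r y)
      + (kr - kr⁻¹) • nablaReEl F r y + (ur - ur⁻¹) • nablaRoEl F r y
  else
    k ^ chiZ (cd r y i - cd r y (i + 1)) • X F r (sW r i y)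
      + (k - k⁻¹) • nablaIel F r i y

/-- The truncated Demazure–Lusztig operators `T_1, …, T_r` on `F[ℝ^r]`. -/
def Top (k kr ur : F) (i : ℕ) : Module.End F (QA F r) := mkOp F r (Tel F r k kr ur i)

/-! ### The torus and the affine generator -/

/-- `t^{ε_i}`: the `i`-th coordinate (`1`-based) of an element of the torus `T = (Fˣ)^r`. -/
def tcU (t : Fin r → Fˣ) (i : ℕ) : Fˣ := ∏ m : Fin r, if (m : ℕ) + 1 = i then t m else 1

/-- `t^λ` for `λ ∈ ℤ^r`. -/
def upow (t : Fin r → Fˣ) (lam : Fin r → ℤ) : Fˣ := ∏ m : Fin r, t m ^ lam m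

/-- `t^v` for a vector `v` with integral entries (entries read off via the floor). -/
def upowR (t : Fin r → Fˣ) (v : E r) : Fˣ := ∏ m : Fin r, t m ^ ⌊v m⌋

/-- The `W`-action on the torus `T = (Fˣ)^r`: for `g = τ(λ)w₀ ∈ W` (so `g y = w₀ y + λ`),
`(g t)_m = q^{λ_m} · t^{w₀⁻¹ ε_m}`, where `W₀` permutes and inverts coordinates and
`τ(λ) t = q^λ t`, with `q = (q^{1/2})²`. -/
def torusAct (qh : Fˣ) (g : E r → E r) (t : Fin r → Fˣ) : Fin r → Fˣ := fun m =>
  (qh * qh) ^ ⌊g 0 m⌋ * ∏ j : Fin r, t j ^ ⌊(g (eV r j) - g 0) m⌋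

/-- The action on the torus of the linear part of `g` alone (the `W₀`-action). -/
def torusAct0 (g : E r → E r) (t : Fin r → Fˣ) : Fin r → Fˣ := fun m =>
  ∏ j : Fin r, t j ^ ⌊(g (eV r j) - g 0) m⌋

/-- The simple affine roots `α₀(y) = 1 - 2y₁`, `α_i(y) = y_i - y_{i+1}` (`1 ≤ i < r`),
`α_r(y) = 2 y_r` as affine-linear functionals. -/
def alphaF (j : ℕ) (y : E r) : ℝ :=
  if j = 0 then 1 - 2 * cd r y 1
  else if j = r then 2 * cd r y r
  else cd r y j - cd r y (j + 1)

/-- `t^{α_j^∨}` where `α₀^∨ = (-ε₁, 1/2)`, `α_i^∨ = (ε_i - ε_{i+1}, 0)`, `α_r^∨ = (ε_r, 0)`. -/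
def tpowCo (qh : Fˣ) (t : Fin r → Fˣ) (j : ℕ) : Fˣ :=
  if j = 0 then qh * (tcU F r t 1)⁻¹
  else if j = r then tcU F r t r
  else tcU F r t j * (tcU F r t (j + 1))⁻¹

/-- The affine subtorus `T_𝒪 = {t ∈ T : t^{α_j^∨} = 1 whenever α_j(c^𝒪) = 0}`. -/
def TOset (qh : Fˣ) (O : Set (E r)) : Set (Fin r → Fˣ) :=
  {t | ∀ j : ℕ, j ≤ r → alphaF r j (cpt r O) = 0 → tpowCo F r qh t j = 1}

/-- `∇₀^e(x^y) = ((1 - (q^{-1/2}x₁)^{⌊-2y₁⌋_e})/(1 - q x₁^{-2}))·x^y`. -/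
def nabla0eEl (qh : F) (y : E r) : QA F r :=
  geomS F r (qh * qh) ((-2 : ℝ) • epsV r 1) (-floorE (-2 * cd r y 1) / 2) * X F r y

/-- `∇₀^o(x^y) = ((q^{1/2}x₁^{-1} - (q^{-1/2}x₁)^{⌊-2y₁⌋_o})/(1 - q x₁^{-2}))·x^y`. -/
def nabla0oEl (qh : F) (y : E r) : QA F r :=
  (qh • X F r ((-1 : ℝ) • epsV r 1)) *
    geomS F r (qh * qh) ((-2 : ℝ) • epsV r 1) ((-floorO (-2 * cd r y 1) - 1) / 2) * X F r y

/-- The value of `T₀^𝒪` on `x^y`. -/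
def T0el (qh : Fˣ) (k0 u0 : F) (t : Fin r → Fˣ) (y : E r) : QA F r :=
  (k0 ^ chiE (2 * cd r y 1) * u0 ^ chiO (2 * cd r y 1) *
      ((tcU F r (torusAct F r qh (gfun r y) t) 1 : Fˣ) : F)) • X F r (sEps1 r y)
    + (k0 - k0⁻¹) • nabla0eEl F r qh y + (u0 - u0⁻¹) • nabla0oEl F r qh y

/-- The operator `T₀^𝒪` (as a globally defined operator; on `F[𝒪]` it is the operator of
the quasi-polynomial representation). -/
def T0op (qh : Fˣ) (k0 u0 : F) (t : Fin r → Fˣ) : Module.End F (QA F r) :=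
  mkOp F r (T0el F r qh k0 u0 t)

/-- The full family `T₀^𝒪, T₁, …, T_r`. -/
def Tfull (qh : Fˣ) (k0 u0 k kr ur : F) (t : Fin r → Fˣ) (j : ℕ) : Module.End F (QA F r) :=
  if j = 0 then T0op F r qh k0 u0 t else Top F r k kr ur j

/-- The Hecke parameter `k_j` (`k₀`, `k` or `k_r`). -/
def kpar (k0 k kr : F) (j : ℕ) : F := if j = 0 then k0 else if j = r then kr else k

/-- `(T_j^𝒪)⁻¹ = T_j^𝒪 - k_j + k_j⁻¹` (the inverse on `F[𝒪]`, by the Hecke relation). -/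
def TfullInv (qh : Fˣ) (k0 u0 k kr ur : F) (t : Fin r → Fˣ) (j : ℕ) : Module.End F (QA F r) :=
  Tfull F r qh k0 u0 k kr ur t j - (kpar F r k0 k kr j - (kpar F r k0 k kr j)⁻¹) • 1

/-- The word `0, 1, …, r-1, r, r-1, …, i` used in the definition of `Y_i^𝒪`. -/
def Ylist (i : ℕ) : List ℕ :=
  0 :: (((List.range (r - 1)).map (· + 1)) ++ [r] ++ ((List.range (r - i)).map fun m => r - 1 - m))

/-- The commuting operators
`Y_i^𝒪 = (T_{i-1}^𝒪)⁻¹⋯(T₁^𝒪)⁻¹ · T₀^𝒪 · T₁^𝒪⋯T_{r-1}^𝒪 · T_r^𝒪 · T_{r-1}^𝒪⋯T_i^𝒪`. -/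
def Yop (qh : Fˣ) (k0 u0 k kr ur : F) (t : Fin r → Fˣ) (i : ℕ) : Module.End F (QA F r) :=
  ((((List.range (i - 1)).map (· + 1)).reverse.map (TfullInv F r qh k0 u0 k kr ur t)).prod) *
    (((Ylist r i).map (Tfull F r qh k0 u0 k kr ur t)).prod)

/-! ### The base points `𝔰^𝒪`, `𝔰_y` and the spectrum -/

/-- `n_i^𝒪` (with `c = c^𝒪`), resp. `m_i(y)` (with `c = y`). -/
def nO (c : E r) (m : Fin r) : ℤ :=
  (∑ j : Fin r, if m < j then eta (c m - c j) + eta (c m + c j) else 0) +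
    ∑ j : Fin r, if j < m then eta (c j + c m) - eta (c j - c m) else 0

/-- The base point `𝔰^𝒪 ∈ T`. -/
def sOtor (k0 u0 k kr ur : Fˣ) (O : Set (E r)) : Fin r → Fˣ := fun m =>
  (k0 * kr) ^ (-(chiE (2 * cpt r O m) : ℤ)) * (u0 * ur) ^ (chiO (2 * cpt r O m) : ℤ) *
    k ^ nO r (cpt r O) m

/-- The eigenvalue `γ_i^𝒪(y) = ((g_y(𝔰^𝒪·t))_i)⁻¹`. -/
def gammaO (qh k0 u0 k kr ur : Fˣ) (O : Set (E r)) (t : Fin r → Fˣ) (i : ℕ) (y : E r) : Fˣ :=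
  (tcU F r (torusAct F r qh (gfun r y) fun m => sOtor F r k0 u0 k kr ur O m * t m) i)⁻¹

/-- `𝔰_y ∈ T`. -/
def sfrak (k0 u0 k kr ur : Fˣ) (y : E r) : Fin r → Fˣ := fun m =>
  (k0 * kr) ^ etaE (2 * y m) * (u0 * ur) ^ etaO (2 * y m) * k ^ nO r y m

/-! ### Finite Weyl group combinatorics, positive roots -/

/-- The set of positive roots of type `C_r`. -/
def PhiPlus : Set (E r) :=
  {v | (∃ a b : Fin r, a < b ∧ v = eV r a - eV r b) ∨
       (∃ a b : Fin r, a < b ∧ v = eV r a + eV r b) ∨ ∃ a : Fin r, v = (2 : ℝ) • eV r a}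

/-- The root system of type `C_r`. -/
def Phi0 : Set (E r) := PhiPlus r ∪ {v | -v ∈ PhiPlus r}

/-- The normalisation factor `κ_w^𝒪 = ∏_{α ∈ Π(w)} 𝐤_α^{χ_e(α(c))}·𝐤_{α/2}^{-χ_o(α(c))}`,
where `Π(w) = {α ∈ Φ₀⁺ : wα ∈ -Φ₀⁺}`, `𝐤_α = 𝐤_{α/2} = k` for short roots and
`𝐤_α = k_r`, `𝐤_{α/2} = u_r` for long roots. -/
def kappaW (k kr ur : Fˣ) (w : E r → E r) (c : E r) : Fˣ :=
  (∏ p : Fin r × Fin r,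
      if p.1 < p.2 ∧ -w (eV r p.1 - eV r p.2) ∈ PhiPlus r then
        k ^ ((chiE (ip r (eV r p.1 - eV r p.2) c) : ℤ) - (chiO (ip r (eV r p.1 - eV r p.2) c) : ℤ))
      else 1) *
  (∏ p : Fin r × Fin r,
      if p.1 < p.2 ∧ -w (eV r p.1 + eV r p.2) ∈ PhiPlus r then
        k ^ ((chiE (ip r (eV r p.1 + eV r p.2) c) : ℤ) - (chiO (ip r (eV r p.1 + eV r p.2) c) : ℤ))
      else 1) *
  ∏ a : Fin r,
      if -w ((2 : ℝ) • eV r a) ∈ PhiPlus r then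
        kr ^ (chiE (ip r ((2 : ℝ) • eV r a) c) : ℤ) * ur ^ (-(chiO (ip r ((2 : ℝ) • eV r a) c) : ℤ))
      else 1

/-- Iterated application `T_{i₁}(T_{i₂}(⋯(T_{i_ℓ}(f))⋯))`. -/
def applyT (k kr ur : F) (l : List ℕ) (f : QA F r) : QA F r :=
  l.foldr (fun i g => Top F r k kr ur i g) f

/-- The length function of the finite Weyl group `W₀`. -/
def w0len (g : E r → E r) : ℕ :=
  sInf {n | ∃ l : List ℕ, (∀ a ∈ l, 1 ≤ a ∧ a ≤ r) ∧ l.length = n ∧ (fun y => wordAct r l y) = g}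

/-- Membership in `W₀` (as maps on `ℝ^r`). -/
def IsW0fun (w : E r → E r) : Prop :=
  ∃ l : List ℕ, (∀ a ∈ l, 1 ≤ a ∧ a ≤ r) ∧ w = fun y => wordAct r l y

/-- Membership in the parabolic subgroup `W_{0,𝒪}` generated by the `s_i`, `1 ≤ i ≤ r`,
with `α_i(c^𝒪) = 0`. -/
def IsWOOfun (O : Set (E r)) (u : E r → E r) : Prop :=
  ∃ l : List ℕ, (∀ a ∈ l, 1 ≤ a ∧ a ≤ r ∧ alphaF r a (cpt r O) = 0) ∧
    u = fun y => wordAct r l y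

/-- `v ∈ W₀^𝒪`: `v ∈ W₀` of minimal length in its coset `v·W_{0,𝒪}`. -/
def MinRep (O : Set (E r)) (v : E r → E r) : Prop :=
  IsW0fun r v ∧ ∀ u, IsWOOfun r O u → w0len r v ≤ w0len r fun y => v (u y)

/-- Membership in the affine Weyl group `W` (as maps on `ℝ^r`). -/
def IsWfun (g : E r → E r) : Prop :=
  ∃ l : List ℕ, (∀ a ∈ l, a ≤ r) ∧ g = fun y => wordAct r l y

/-- Membership in the parabolic subgroup `W_{J(𝒪)}` generated by the `s_j`, `j ∈ J(𝒪)`. -/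
def IsWJfun (O : Set (E r)) (u : E r → E r) : Prop :=
  ∃ l : List ℕ, (∀ a ∈ l, a ≤ r ∧ alphaF r a (cpt r O) = 0) ∧ u = fun y => wordAct r l y

/-- The `W`-action on the Laurent polynomials `F[ℤ^r]` by `q`-dilations and reflections:
`w(x^μ) = x^{wμ}` for `w ∈ W₀`, `τ(λ)(x^μ) = q^{-⟨μ,λ⟩} x^μ` (globally defined via the
linear/translation parts of `g`). -/
def LWact (qh : Fˣ) (g : E r → E r) : Module.End F (QA F r) :=
  mkOp F r fun v => (((qh * qh) ^ (-⌊ip r (g v - g 0) (g 0)⌋) : Fˣ) : F) • X F r (g v - g 0)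

/-! ### roots `ᾱ_j`, torus reflections -/

/-- The finite simple roots `ᾱ₀ = -2ε₁`, `ᾱ_i = ε_i - ε_{i+1}`, `ᾱ_r = 2ε_r`
(as integral vectors). -/
def abarI (j : ℕ) : Fin r → ℤ := fun m =>
  if j = 0 then (if (m : ℕ) = 0 then -2 else 0)
  else if j = r then (if (m : ℕ) + 1 = r then 2 else 0)
  else if (m : ℕ) + 1 = j then 1
  else if (m : ℕ) = j then -1
  else 0

/-- The corresponding coroots `ᾱ₀^∨ = -ε₁`, `ᾱ_i^∨ = ε_i - ε_{i+1}`, `ᾱ_r^∨ = ε_r`. -/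
def abarV (j : ℕ) : Fin r → ℤ := fun m =>
  if j = 0 then (if (m : ℕ) = 0 then -1 else 0)
  else if j = r then (if (m : ℕ) + 1 = r then 1 else 0)
  else if (m : ℕ) + 1 = j then 1
  else if (m : ℕ) = j then -1
  else 0

/-- `ᾱ_j` as a real vector. -/
def abarR (j : ℕ) : E r := fun m => ((abarI r j m : ℤ) : ℝ)

/-- The constants `c₀ = u₀u_r`, `c_i = k²`, `c_r = k₀k_r`. -/
def cpar (k0 u0 k kr ur : Fˣ) (j : ℕ) : Fˣ :=
  if j = 0 then u0 * ur else if j = r then k0 * kr else k * k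

/-- The action of the reflection `s_{ᾱ_j} ∈ W₀` on the torus `T` (with `s_{ᾱ₀} = s_{ε₁}`). -/
def sTor (j : ℕ) (t : Fin r → Fˣ) : Fin r → Fˣ := fun m =>
  if j = 0 then (if (m : ℕ) = 0 then (t m)⁻¹ else t m)
  else if j = r then (if (m : ℕ) + 1 = r then (t m)⁻¹ else t m)
  else if (m : ℕ) + 1 = j then tcU F r t (j + 1)
  else if (m : ℕ) = j then tcU F r t j
  else t m

/-! ### The operators `G_t^𝒪(a)` for affine roots `a = (α, n)` -/

/-- The coroot `α^∨ = 2α/⟨α,α⟩`. -/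
def coroot (v : E r) : E r := ((2 : ℝ) / ip r v v) • v

/-- The scalar `q^{2n/⟨α,α⟩}` appearing in `x^{a^∨}` for `a = (α,n)`. -/
def qsc (qh : Fˣ) (v : E r) (n : ℤ) : Fˣ := if ip r v v = 4 then qh ^ n else (qh * qh) ^ n

/-- `𝐤_a`: `k` if `α` is short; `k_r` if `α` long, `n` even; `k₀` if `α` long, `n` odd. -/
def kaf (k0 k kr : Fˣ) (v : E r) (n : ℤ) : Fˣ :=
  if ip r v v = 4 then (if Even n then kr else k0) else k

/-- `𝐤_{a/2}`: `k` if `α` is short; `u_r` if `α` long, `n` even; `u₀` if `α` long, `n` odd. -/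
def khaf (u0 k ur : Fˣ) (v : E r) (n : ℤ) : Fˣ :=
  if ip r v v = 4 then (if Even n then ur else u0) else k

/-- The reflection `s_α(y) = y - α(y)·α^∨`. -/
def sRefl (v y : E r) : E r := y - ip r v y • coroot r v

/-- `s_{a,t}(x^y) = (g_y t)^{-n α^∨} · x^{s_α y}`. -/
def saTel (qh : Fˣ) (t : Fin r → Fˣ) (v : E r) (n : ℤ) (y : E r) : QA F r :=
  ((upowR F r (torusAct F r qh (gfun r y) t) (((-n : ℤ) : ℝ) • coroot r v) : Fˣ) : F) •
    X F r (sRefl r v y)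

/-- The twisted reflection operator `s_{a,t}`. -/
def SaOp (qh : Fˣ) (t : Fin r → Fˣ) (v : E r) (n : ℤ) : Module.End F (QA F r) :=
  mkOp F r (saTel F r qh t v n)

/-- The value `G_t^𝒪(a)(x^y)` for the affine root `a = (v, n)`. -/
def Gel (qh k0 u0 k kr ur : Fˣ) (t : Fin r → Fˣ) (v : E r) (n : ℤ) (y : E r) : QA F r :=
  (((kaf F r k0 k kr v n : Fˣ) : F) ^ chiE (ip r v y) *
      ((khaf F r u0 k ur v n : Fˣ) : F) ^ chiO (ip r v y)) • X F r y
    + ((((kaf F r k0 k kr v n : Fˣ) : F) - ((kaf F r k0 k kr v n : Fˣ) : F)⁻¹) •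
          geomS F r (((qsc F r qh v n)⁻¹ * (qsc F r qh v n)⁻¹ : Fˣ) : F)
            ((-2 : ℝ) • coroot r v) (-floorE (ip r v y) / 2)
        + (((khaf F r u0 k ur v n : Fˣ) : F) - ((khaf F r u0 k ur v n : Fˣ) : F)⁻¹) •
          ((((qsc F r qh v n)⁻¹ : Fˣ) : F) • X F r ((-1 : ℝ) • coroot r v) *
            geomS F r (((qsc F r qh v n)⁻¹ * (qsc F r qh v n)⁻¹ : Fˣ) : F)
              ((-2 : ℝ) • coroot r v) (-(floorO (ip r v y) + 1) / 2))) *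
      saTel F r qh t v n y

/-- The operator `G_t^𝒪(a)` for `a = (v, n)`. -/
def Gop (qh k0 u0 k kr ur : Fˣ) (t : Fin r → Fˣ) (v : E r) (n : ℤ) : Module.End F (QA F r) :=
  mkOp F r (Gel F r qh k0 u0 k kr ur t v n)

/-- The twisted action `g_t` of `g ∈ W` on `F[𝒪]`:
`g_t(x^y) = (g_{w₀ y} t)^{-λ} x^{w₀ y}` for `g = τ(λ) w₀`. -/
def Wtw (qh : Fˣ) (t : Fin r → Fˣ) (g : E r → E r) : Module.End F (QA F r) :=
  mkOp F r fun y =>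
    (((upowR F r (torusAct F r qh (gfun r (g y - g 0)) t) (g 0))⁻¹ : Fˣ) : F) •
      X F r (g y - g 0)

/-! ### The operators `D_j` -/

/-- The palindromic word `1, …, r-1, r, r-1, …, 1`. -/
def palin : List ℕ :=
  ((List.range (r - 1)).map (· + 1)) ++ [r] ++ ((List.range (r - 1)).map (· + 1)).reverse

/-- Multiplication by `x^{-ε₁}`. -/
def Mop : Module.End F (QA F r) := mkOp F r fun y => X F r ((-1 : ℝ) • epsV r 1) * X F r y

/-- `D₀ = (T₁^𝒪 ⋯ T_{r-1}^𝒪 T_r^𝒪 T_{r-1}^𝒪 ⋯ T₁^𝒪)⁻¹ ∘ M`. -/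
def D0op (qh : Fˣ) (k0 u0 k kr ur : F) (t : Fin r → Fˣ) : Module.End F (QA F r) :=
  ((palin r).map (TfullInv F r qh k0 u0 k kr ur t)).prod * Mop F r

/-- `D_j`: `D₀` for `j = 0` and `T_j^𝒪` for `1 ≤ j ≤ r`. -/
def Dop (qh : Fˣ) (k0 u0 k kr ur : F) (t : Fin r → Fˣ) (j : ℕ) : Module.End F (QA F r) :=
  if j = 0 then D0op F r qh k0 u0 k kr ur t else Tfull F r qh k0 u0 k kr ur t j

/-- Iterated application `D_{j₁}(D_{j₂}(⋯(D_{j_ℓ}(f))⋯))`. -/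
def applyD (qh : Fˣ) (k0 u0 k kr ur : F) (t : Fin r → Fˣ) (l : List ℕ) (f : QA F r) : QA F r :=
  l.foldr (fun j g => Dop F r qh k0 u0 k kr ur t j g) f

/-- The coefficients `k_{s_j}(y)`. -/
def ksj (k kr ur : Fˣ) (j : ℕ) (y : E r) : Fˣ :=
  if j = 0 then
    kr ^ (-etaE (2 * cd r y 1)) * ur ^ (-etaO (2 * cd r y 1)) *
      ∏ m : Fin r,
        (if 1 ≤ (m : ℕ) then k ^ (-eta (cd r y 1 - y m) - eta (cd r y 1 + y m)) else 1)
  else if j = r then kr ^ (-etaE (2 * cd r y r)) * ur ^ (-etaO (2 * cd r y r))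
  else k ^ (-eta (cd r y j - cd r y (j + 1)))

/-- `k_w(c) = ∏_m k_{s_{j_m}}(s_{j_{m+1}} ⋯ s_{j_ℓ} c)` for the word `w = s_{j₁} ⋯ s_{j_ℓ}`. -/
def kword (k kr ur : Fˣ) (l : List ℕ) (z : E r) : Fˣ :=
  (l.foldr (fun j p => (genF r j p.1, ksj F r k kr ur j p.1 * p.2)) (z, (1 : Fˣ))).2

set_option linter.unusedSectionVars false
set_option linter.unusedVariables false
set_option linter.unusedSimpArgs false

/-! ### Basic facts about quasi-monomials and operators -/

theorem X_mul (y z : E r) : X F r y * X F r z = X F r (y + z) := by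
  simp [X, AddMonoidAlgebra.single_mul_single]

theorem X_zero : X F r 0 = 1 := by
  simp [X, AddMonoidAlgebra.one_def]

theorem mkOp_X (Ψ : E r → QA F r) (y : E r) : mkOp F r Ψ (X F r y) = Ψ y := by
  simp [mkOp, X]

theorem end_ext {f g : Module.End F (QA F r)} (h : ∀ y, f (X F r y) = g (X F r y)) : f = g := by
  refine (AddMonoidAlgebra.basis (E r) F).ext ?_
  intro y
  simpa [X] using h y

/-- Multiplication by `c x^v`. -/
def mulX (c : F) (v : E r) : Module.End F (QA F r) := LinearMap.mulLeft F (c • X F r v)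

theorem mulX_X (c : F) (v y : E r) : mulX F r c v (X F r y) = c • X F r (v + y) := by
  simp [mulX, X_mul]

theorem mulX_apply (c : F) (v : E r) (f : QA F r) : mulX F r c v f = c • (X F r v * f) := by
  simp [mulX]

theorem mulX_mul (c d : F) (v w : E r) :
    mulX F r c v * mulX F r d w = mulX F r (c * d) (v + w) := by
  apply end_ext
  intro y
  simp [mulX_X, smul_smul, mul_comm c d, add_assoc]

theorem mulX_one : mulX F r 1 0 = 1 := by
  apply end_ext
  intro y
  simp [mulX_X]

theorem mulX_inv (c : F) (hc : c ≠ 0) (v : E r) :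
    mulX F r c v * mulX F r c⁻¹ (-v) = 1 := by
  rw [mulX_mul, mul_inv_cancel₀ hc, add_neg_cancel, mulX_one]

theorem mulX_inv' (c : F) (hc : c ≠ 0) (v : E r) :
    mulX F r c⁻¹ (-v) * mulX F r c v = 1 := by
  rw [mulX_mul, inv_mul_cancel₀ hc, neg_add_cancel, mulX_one]

/-! ### Truncated geometric series -/

theorem geomS_zero (c : F) (v : E r) : geomS F r c v 0 = 0 := by
  simp [geomS]

theorem geomS_succ (c : F) (v : E r) (m : ℤ) :
    geomS F r c v (m + 1) = geomS F r c v m + c ^ m • X F r ((m : ℝ) • v) := by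
  unfold geomS
  rcases lt_trichotomy m (-1) with h | h | h
  · obtain ⟨n, rfl⟩ : ∃ n : ℕ, m = -(n : ℤ) - 2 := ⟨(-m - 2).toNat, by omega⟩
    rw [if_neg (by omega), if_neg (by omega)]
    have h1 : (-(-(n : ℤ) - 2 + 1)).toNat = n + 1 := by omega
    have h2 : (-(-(n : ℤ) - 2)).toNat = n + 1 + 1 := by omega
    rw [h1, h2, Finset.sum_range_succ _ (n + 1)]
    have h3 : (-((n + 1 : ℕ) : ℤ) - 1) = -(n : ℤ) - 2 := by push_cast; ring
    have h4 : (-((n + 1 : ℕ) : ℝ) - 1) = ((-(n : ℤ) - 2 : ℤ) : ℝ) := by push_cast; ring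
    rw [h3, h4]
    abel
  · subst h
    simp
  · obtain ⟨n, rfl⟩ : ∃ n : ℕ, m = (n : ℤ) := ⟨m.toNat, by omega⟩
    rw [if_pos (by omega), if_pos (by omega)]
    have h1 : ((n : ℤ) + 1).toNat = n + 1 := by omega
    rw [h1, Finset.sum_range_succ]
    simp

theorem geomS_mul (c : F) (hc : c ≠ 0) (v : E r) (m : ℤ) :
    c • (X F r v * geomS F r c v m) = geomS F r c v m + c ^ m • X F r ((m : ℝ) • v) - 1 := by
  have key : ∀ m : ℤ, c • (X F r v * (c ^ m • X F r ((m : ℝ) • v)))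
      = c ^ (m + 1) • X F r (((m + 1 : ℤ) : ℝ) • v) := by
    intro m
    rw [mul_smul_comm, X_mul, smul_smul, zpow_add₀ hc, zpow_one, mul_comm c]
    congr 2
    push_cast
    module
  induction m using Int.induction_on with
  | zero => simp [geomS_zero, X_zero]
  | succ n ih =>
    rw [geomS_succ, mul_add, smul_add, ih, key]
    abel
  | pred n ih =>
    have h := geomS_succ F r c v (-(n : ℤ) - 1)
    rw [sub_add_cancel] at h
    have h2 := key (-(n : ℤ) - 1)
    rw [sub_add_cancel] at h2
    rw [h, mul_add, smul_add, h2] at ih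
    rw [add_left_inj (a := c ^ (-(n : ℤ)) • X F r (((-(n : ℤ) : ℤ) : ℝ) • v)) |>.symm, ih]
    abel

theorem geomS_one (c : F) (v : E r) : geomS F r c v 1 = 1 := by
  have := geomS_succ F r c v 0
  simpa [geomS_zero, X_zero] using this

theorem geomS_neg_one (c : F) (v : E r) : geomS F r c v (-1) = - (c⁻¹ • X F r (-v)) := by
  have := geomS_succ F r c v (-1)
  simp [geomS_zero] at this
  exact eq_neg_of_add_eq_zero_left this.symm

/-- operators commuting with multiplication by `c x^v` commute with multiplication by the
truncated geometric series. -/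
theorem geomS_comm (T : Module.End F (QA F r)) (c : F) (hc : c ≠ 0) (v : E r)
    (h : ∀ f, T (X F r v * f) = X F r v * T f) (m : ℤ) (f : QA F r) :
    T (geomS F r c v m * f) = geomS F r c v m * T f := by
  have hneg : ∀ f, T (X F r (-v) * f) = X F r (-v) * T f := by
    intro f
    have e1 : ∀ g, X F r v * (X F r (-v) * g) = g := by
      intro g; rw [← mul_assoc, X_mul, add_neg_cancel, X_zero, one_mul]
    have e2 : ∀ g, X F r (-v) * (X F r v * g) = g := by
      intro g; rw [← mul_assoc, X_mul, neg_add_cancel, X_zero, one_mul]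
    rw [← e2 (T (X F r (-v) * f)), ← h, e1]
  have hz : ∀ (m : ℤ) f, T (X F r ((m : ℝ) • v) * f) = X F r ((m : ℝ) • v) * T f := by
    intro m
    induction m using Int.induction_on with
    | zero => intro f; simp [X_zero]
    | succ n ih =>
      intro f
      have e : (((n : ℤ) + 1 : ℤ) : ℝ) • v = ((n : ℤ) : ℝ) • v + v := by push_cast; module
      rw [e, ← X_mul, mul_assoc, ih, h, mul_assoc]
    | pred n ih =>
      intro f
      have e : ((-(n : ℤ) - 1 : ℤ) : ℝ) • v = ((-(n : ℤ) : ℤ) : ℝ) • v + (-v) := by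
        push_cast; module
      rw [e, ← X_mul, mul_assoc, ih, hneg, mul_assoc]
  induction m using Int.induction_on with
  | zero => simp [geomS_zero]
  | succ n ih =>
    rw [geomS_succ, add_mul, map_add, ih, smul_mul_assoc, map_smul, hz, add_mul, smul_mul_assoc]
  | pred n ih =>
    have h := geomS_succ F r c v (-(n : ℤ) - 1)
    rw [sub_add_cancel] at h
    rw [← sub_eq_iff_eq_add] at h
    rw [← h, sub_mul, map_sub, ih, smul_mul_assoc, map_smul, hz, sub_mul, smul_mul_assoc]

/-! ### The two types of rank one operators -/

theorem chiZ_add_int (s : ℝ) (n : ℤ) : chiZ (s + n) = chiZ s := by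
  unfold chiZ
  congr 1
  apply propext
  constructor
  · rintro ⟨m, hm⟩; exact ⟨m - n, by push_cast; linarith⟩
  · rintro ⟨m, hm⟩; exact ⟨m + n, by push_cast; linarith⟩

theorem chiZ_int (n : ℤ) : chiZ (n : ℝ) = 1 := by
  unfold chiZ; rw [if_pos ⟨n, rfl⟩]

theorem chiZ_zero : chiZ 0 = 1 := by simpa using chiZ_int 0

theorem chiZ_one : chiZ 1 = 1 := by simpa using chiZ_int 1

theorem chiZ_neg (s : ℝ) : chiZ (-s) = chiZ s := by
  unfold chiZ
  congr 1
  apply propext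
  constructor
  · rintro ⟨m, hm⟩; exact ⟨-m, by push_cast; linarith⟩
  · rintro ⟨m, hm⟩; exact ⟨-m, by push_cast; linarith⟩

theorem chiZ_between (s : ℝ) (n : ℤ) (h1 : (n : ℝ) < s) (h2 : s < n + 1) : chiZ s = 0 := by
  unfold chiZ
  rw [if_neg]
  rintro ⟨m, rfl⟩
  have a : n < m := by exact_mod_cast h1
  have b : m < n + 1 := by exact_mod_cast h2
  omega

/-- The value on `x^y` of the type `A` truncated Demazure-Lusztig operator. -/
def Ael (p : E r →ₗ[ℝ] ℝ) (v : E r) (k : F) (y : E r) : QA F r :=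
  k ^ chiZ (p y) • X F r (y - p y • v) + (k - k⁻¹) • (geomS F r 1 v (-⌊p y⌋) * X F r y)

/-- The type `A` truncated Demazure-Lusztig operator. -/
def Aop (p : E r →ₗ[ℝ] ℝ) (v : E r) (k : F) : Module.End F (QA F r) := mkOp F r (Ael F r p v k)

/-- The value on `x^y` of the type `B` truncated Demazure-Lusztig operator. -/
def Bel (l : E r →ₗ[ℝ] ℝ) (w : E r) (c k u : F) (ψ : ℝ → F) (y : E r) : QA F r :=
  (k ^ chiZ (l y) * u ^ chiZ (l y + 1 / 2) * ψ (l y)) • X F r (y - (2 * l y) • w)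
    + (k - k⁻¹) • (geomS F r (c * c) ((2 : ℝ) • w) (-⌊l y⌋) * X F r y)
    + (u - u⁻¹) • ((c • X F r w) * geomS F r (c * c) ((2 : ℝ) • w) (-⌊l y + 1 / 2⌋) * X F r y)

/-- The type `B` truncated Demazure-Lusztig operator. -/
def Bop (l : E r →ₗ[ℝ] ℝ) (w : E r) (c k u : F) (ψ : ℝ → F) : Module.End F (QA F r) :=
  mkOp F r (Bel F r l w c k u ψ)

variable {F r}

theorem Aop_X (p : E r →ₗ[ℝ] ℝ) (v : E r) (k : F) (y : E r) :
    Aop F r p v k (X F r y) = Ael F r p v k y := mkOp_X F r _ y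

theorem Bop_X (l : E r →ₗ[ℝ] ℝ) (w : E r) (c k u : F) (ψ : ℝ → F) (y : E r) :
    Bop F r l w c k u ψ (X F r y) = Bel F r l w c k u ψ y := mkOp_X F r _ y

/-- cross relation, pairing `1` -/
theorem Aop_cross_one (p : E r →ₗ[ℝ] ℝ) (v : E r) (k : F) (la : E r) (h : p la = 1) :
    Aop F r p v k * mulX F r 1 la = mulX F r 1 (la - v) * (Aop F r p v k - (k - k⁻¹) • 1) := by
  apply end_ext
  intro y
  simp only [Module.End.mul_apply, LinearMap.sub_apply, LinearMap.smul_apply, Module.End.one_apply,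
    X_mul, one_smul, Aop_X, map_sub, map_smul, mulX_apply]
  unfold Ael
  have hp : p (la + y) = p y + (1 : ℤ) := by rw [map_add, h]; push_cast; ring
  rw [hp, chiZ_add_int, Int.floor_add_intCast]
  have e1 : X F r (la + y - (p y + (1 : ℤ)) • v) = X F r (la - v) * X F r (y - p y • v) := by
    rw [X_mul]; congr 1; push_cast; module
  have g1 := geomS_succ F r 1 v (-⌊p y⌋ - 1)
  have g2 := geomS_mul F r 1 one_ne_zero v (-⌊p y⌋)
  simp only [one_zpow, one_smul, sub_add_cancel] at g1 g2
  rw [neg_add']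
  have e2 : X F r (la + y) = X F r v * X F r (la - v) * X F r y := by
    rw [X_mul, X_mul]; congr 1; module
  have e4 : X F r (la - v + y) = X F r (la - v) * X F r y := by rw [X_mul]
  have e3 : X F r (((-⌊p y⌋ : ℤ) : ℝ) • v) = X F r (((-⌊p y⌋ - 1 : ℤ) : ℝ) • v) * X F r v := by
    rw [X_mul]; congr 1; push_cast; module
  rw [e1, e2, e4]
  rw [e3] at g2
  simp only [Algebra.smul_def]
  generalize algebraMap F (QA F r) (k - k⁻¹) = h at *
  linear_combination (-h * X F r v * X F r (la - v) * X F r y) * g1 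
    + h * X F r (la - v) * X F r y * g2

/-- cross relation, pairing `-1` -/
theorem Aop_cross_neg_one (p : E r →ₗ[ℝ] ℝ) (v : E r) (k : F) (la : E r) (h : p la = -1) :
    Aop F r p v k * mulX F r 1 la
      = mulX F r 1 (la + v) * Aop F r p v k + (k - k⁻¹) • mulX F r 1 la := by
  apply end_ext
  intro y
  simp only [Module.End.mul_apply, LinearMap.add_apply, LinearMap.smul_apply, Module.End.one_apply,
    X_mul, one_smul, Aop_X, map_add, map_smul, mulX_apply]
  unfold Ael
  have hp : p (la + y) = p y + (-1 : ℤ) := by rw [map_add, h]; push_cast; ring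
  rw [hp, chiZ_add_int, Int.floor_add_intCast]
  have e1 : X F r (la + y - (p y + (-1 : ℤ)) • v) = X F r (la + v) * X F r (y - p y • v) := by
    rw [X_mul]; congr 1; push_cast; module
  have g1 := geomS_succ F r 1 v (-⌊p y⌋)
  have g2 := geomS_mul F r 1 one_ne_zero v (-⌊p y⌋)
  simp only [one_zpow, one_smul, sub_add_cancel] at g1 g2
  rw [neg_add, neg_neg]
  have e2 : X F r (la + v) = X F r la * X F r v  := by
    rw [X_mul]
  have e4 : X F r (la + y) = X F r la * X F r y := by rw [X_mul]
  rw [e1, e2, e4]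
  simp only [Algebra.smul_def]
  generalize algebraMap F (QA F r) (k - k⁻¹) = h at *
  linear_combination (h * X F r la * X F r y) * g1 - h * X F r la * X F r y * g2

/-- cross relation, pairing `0` -/
theorem Aop_cross_zero (p : E r →ₗ[ℝ] ℝ) (v : E r) (k c : F) (la : E r) (h : p la = 0) :
    Aop F r p v k * mulX F r c la = mulX F r c la * Aop F r p v k := by
  apply end_ext
  intro y
  simp only [Module.End.mul_apply, X_mul, Aop_X, map_smul, mulX_apply]
  unfold Ael
  rw [map_add, h, zero_add, mul_add, mul_smul_comm, mul_smul_comm, X_mul, mul_left_comm, X_mul,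
    add_sub_assoc]

theorem Bop_cross_zero (l : E r →ₗ[ℝ] ℝ) (w : E r) (c k u d : F) (ψ : ℝ → F)
    (la : E r) (h : l la = 0) :
    Bop F r l w c k u ψ * mulX F r d la = mulX F r d la * Bop F r l w c k u ψ := by
  apply end_ext
  intro y
  simp only [Module.End.mul_apply, X_mul, Bop_X, map_smul, mulX_apply]
  unfold Bel
  rw [map_add, h, zero_add]
  have e1 : X F r (la + y) = X F r la * X F r y := by rw [X_mul]
  have e2 : X F r (la + y - (2 * l y) • w) = X F r la * X F r (y - (2 * l y) • w) := by
    rw [X_mul, add_sub_assoc]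
  rw [e1, e2]
  simp only [Algebra.smul_def]
  ring

theorem geomS_aux (c : F) (hc : c ≠ 0) (w : E r) (m : ℤ) :
    ∃ Z : QA F r, (c • X F r w) * (c • X F r w) * geomS F r (c * c) ((2 : ℝ) • w) m
        = geomS F r (c * c) ((2 : ℝ) • w) m + Z - 1 ∧
      geomS F r (c * c) ((2 : ℝ) • w) (m + 1) = geomS F r (c * c) ((2 : ℝ) • w) m + Z ∧
      geomS F r (c * c) ((2 : ℝ) • w) (m - 1) = geomS F r (c * c) ((2 : ℝ) • w) m
        - Z * (c⁻¹ • X F r (-w)) * (c⁻¹ • X F r (-w)) := by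
  have hcc : c * c ≠ 0 := mul_ne_zero hc hc
  refine ⟨(c * c) ^ m • X F r ((m : ℝ) • (2 : ℝ) • w), ?_, geomS_succ _ _ _ _ _, ?_⟩
  · rw [← geomS_mul _ _ _ hcc, smul_mul_smul_comm, X_mul, smul_mul_assoc]
    congr 4
    module
  · have h := geomS_succ F r (c * c) ((2 : ℝ) • w) (m - 1)
    rw [sub_add_cancel] at h
    rw [h, smul_mul_smul_comm, smul_mul_smul_comm, X_mul, X_mul]
    have e1 : (c * c) ^ m * c⁻¹ * c⁻¹ = (c * c) ^ (m - 1) := by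
      rw [zpow_sub_one₀ hcc]; field_simp
    have e2 : (m : ℝ) • (2 : ℝ) • w + -w + -w = ((m - 1 : ℤ) : ℝ) • (2 : ℝ) • w := by
      push_cast; module
    rw [e1, e2]
    abel

/-- cross relation for type `B` -/
theorem Bop_cross (l : E r →ₗ[ℝ] ℝ) (w : E r) (c k u : F) (ψ : ℝ → F) (hc : c ≠ 0)
    (h : l w = 1) (hψ : ∀ s, ψ (s + 1) = c⁻¹ * c⁻¹ * ψ s) :
    Bop F r l w c k u ψ * mulX F r c w
      = mulX F r c⁻¹ (-w) * (Bop F r l w c k u ψ - (k - k⁻¹) • 1) - (u - u⁻¹) • 1 := by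
  apply end_ext
  intro y
  simp only [Module.End.mul_apply, LinearMap.sub_apply, LinearMap.smul_apply, Module.End.one_apply,
    X_mul, Bop_X, map_sub, map_smul, mulX_apply]
  unfold Bel
  have hp : l (w + y) = l y + (1 : ℤ) := by rw [map_add, h]; push_cast; ring
  have hp2 : l y + (1 : ℤ) + 1 / 2 = l y + 1 / 2 + (1 : ℤ) := by ring
  rw [hp, hp2, chiZ_add_int, chiZ_add_int, Int.floor_add_intCast, Int.floor_add_intCast]
  have e1 : X F r (w + y - (2 * (l y + (1 : ℤ))) • w) = X F r (-w) * X F r (y - (2 * l y) • w) := by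
    rw [X_mul]; congr 1; push_cast; module
  obtain ⟨Z, g1, g2, g3⟩ := geomS_aux c hc w (-⌊l y⌋)
  obtain ⟨Z', g1', g2', g3'⟩ := geomS_aux c hc w (-⌊l y + 1 / 2⌋)
  have e3 : (c • X F r w) * (c⁻¹ • X F r (-w)) = 1 := by
    rw [smul_mul_smul_comm, mul_inv_cancel₀ hc, X_mul, add_neg_cancel, X_zero, one_smul]
  have e5 : algebraMap F (QA F r) c * algebraMap F (QA F r) c⁻¹ = 1 := by
    rw [← map_mul, mul_inv_cancel₀ hc, map_one]
  have e2 : X F r (w + y) = X F r w * X F r y := by rw [X_mul]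
  have e4 : X F r (-w + y) = X F r (-w) * X F r y := by rw [X_mul]
  have e6 : ψ (l y + (1 : ℤ)) = c⁻¹ * c⁻¹ * ψ (l y) := by rw [← hψ]; norm_num
  rw [neg_add', neg_add', e1, e2, e4, e6, g3, g3']
  generalize geomS F r (c * c) ((2 : ℝ) • w) (-⌊l y⌋) = G at *
  generalize geomS F r (c * c) ((2 : ℝ) • w) (-⌊l y + 1 / 2⌋) = G' at *
  generalize X F r (y - (2 * l y) • w) = S at *
  simp only [Algebra.smul_def, map_mul] at *
  generalize algebraMap F (QA F r) (k - k⁻¹) = h at *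
  generalize algebraMap F (QA F r) (u - u⁻¹) = g at *
  generalize algebraMap F (QA F r) c = C at *
  generalize algebraMap F (QA F r) c⁻¹ = D at *
  generalize X F r (-w) = P' at *
  generalize X F r w = P at *
  generalize X F r y = Y at *
  generalize algebraMap F (QA F r) (ψ (l y)) = a at *
  generalize algebraMap F (QA F r) (k ^ chiZ (l y)) = a1 at *
  generalize algebraMap F (QA F r) (u ^ chiZ (l y + 1 / 2)) = a2 at *
  linear_combination (a1 * a2 * D * a * P' * S) * e5 + h * Y * D * P' * g1
    + g * Y * g1' - h * Y * (C * P * G + Z * D * P') * e3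
    - g * Y * (Z' * (C * P * D * P' + 1) + G') * e3

/-- cross relation for type `B`, inverse variable -/
theorem Bop_cross_inv (l : E r →ₗ[ℝ] ℝ) (w : E r) (c k u : F) (ψ : ℝ → F) (hc : c ≠ 0)
    (h : l w = 1) (hψ : ∀ s, ψ (s + 1) = c⁻¹ * c⁻¹ * ψ s) :
    Bop F r l w c k u ψ * mulX F r c⁻¹ (-w)
      = mulX F r c w * Bop F r l w c k u ψ + (k - k⁻¹) • mulX F r c⁻¹ (-w) + (u - u⁻¹) • 1 := by
  apply end_ext
  intro y
  simp only [Module.End.mul_apply, LinearMap.add_apply, LinearMap.smul_apply, Module.End.one_apply,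
    X_mul, Bop_X, map_add, map_smul, mulX_apply]
  unfold Bel
  have hp : l (-w + y) = l y + (-1 : ℤ) := by rw [map_add, map_neg, h]; push_cast; ring
  have hp2 : l y + (-1 : ℤ) + 1 / 2 = l y + 1 / 2 + (-1 : ℤ) := by ring
  rw [hp, hp2, chiZ_add_int, chiZ_add_int, Int.floor_add_intCast, Int.floor_add_intCast]
  have e1 : X F r (-w + y - (2 * (l y + (-1 : ℤ))) • w) = X F r w * X F r (y - (2 * l y) • w) := by
    rw [X_mul]; congr 1; push_cast; module
  obtain ⟨Z, g1, g2, g3⟩ := geomS_aux c hc w (-⌊l y⌋)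
  obtain ⟨Z', g1', g2', g3'⟩ := geomS_aux c hc w (-⌊l y + 1 / 2⌋)
  have e3 : (c • X F r w) * (c⁻¹ • X F r (-w)) = 1 := by
    rw [smul_mul_smul_comm, mul_inv_cancel₀ hc, X_mul, add_neg_cancel, X_zero, one_smul]
  have e5 : algebraMap F (QA F r) c * algebraMap F (QA F r) c⁻¹ = 1 := by
    rw [← map_mul, mul_inv_cancel₀ hc, map_one]
  have e2 : X F r (-w + y) = X F r (-w) * X F r y := by rw [X_mul]
  have e6 : ψ (l y + (-1 : ℤ)) = c * c * ψ (l y) := by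
    have := hψ (l y - 1)
    rw [sub_add_cancel] at this
    rw [this]
    push_cast
    rw [← sub_eq_add_neg]
    field_simp
  rw [neg_add, neg_neg, neg_add, neg_neg, e1, e2, e6, g2, g2']
  generalize geomS F r (c * c) ((2 : ℝ) • w) (-⌊l y⌋) = G at *
  generalize geomS F r (c * c) ((2 : ℝ) • w) (-⌊l y + 1 / 2⌋) = G' at *
  generalize X F r (y - (2 * l y) • w) = S at *
  simp only [Algebra.smul_def, map_mul] at *
  generalize algebraMap F (QA F r) (k - k⁻¹) = h at *
  generalize algebraMap F (QA F r) (u - u⁻¹) = g at *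
  generalize algebraMap F (QA F r) c = C at *
  generalize algebraMap F (QA F r) c⁻¹ = D at *
  generalize X F r (-w) = P' at *
  generalize X F r w = P at *
  generalize X F r y = Y at *
  generalize algebraMap F (QA F r) (ψ (l y)) = a at *
  generalize algebraMap F (QA F r) (k ^ chiZ (l y)) = a1 at *
  generalize algebraMap F (QA F r) (u ^ chiZ (l y + 1 / 2)) = a2 at *
  linear_combination (a1 * a2 * C * a * P * S) * e5 - h * Y * D * P' * g1
    - g * Y * g1' + h * Y * (C * P * G) * e3 + g * Y * (G' + Z') * e3



/-! ### Abstract Hecke algebra computations -/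

section abstract

variable {R : Type*} [Ring R] [Algebra F R]

theorem abs_A2_x (a b x1 x2 x3 : R) (h : F) (ha : a * a = h • a + 1) (hb : b * b = h • b + 1)
    (c1 : a * x1 = x2 * (a - h • 1)) (c2 : b * x2 = x3 * (b - h • 1))
    (c3 : b * x1 = x1 * b) (c4 : a * x3 = x3 * a) :
    (a * b * a - b * a * b) * x1 = x3 * (a * b * a - b * a * b) := by
  have e1 : a * b * a * x1 = x3 * (a * (b - h • 1) * (a - h • 1)) := by
    calc a * b * a * x1 = a * (b * (a * x1)) := by noncomm_ring
      _ = a * ((b * x2) * (a - h • 1)) := by rw [c1]; noncomm_ring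
      _ = (a * x3) * ((b - h • 1) * (a - h • 1)) := by rw [c2]; noncomm_ring
      _ = _ := by rw [c4]; noncomm_ring
  have e2 : b * a * b * x1 = x3 * ((b - h • 1) * (a - h • 1) * b) := by
    calc b * a * b * x1 = b * (a * (b * x1)) := by noncomm_ring
      _ = b * ((a * x1) * b) := by rw [c3]; noncomm_ring
      _ = (b * x2) * ((a - h • 1) * b) := by rw [c1]; noncomm_ring
      _ = _ := by rw [c2]; noncomm_ring
  rw [sub_mul, e1, e2, ← mul_sub]
  congr 1
  simp only [mul_sub, sub_mul, mul_smul_comm, smul_mul_assoc, mul_one, one_mul, smul_sub, ha, hb,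
    smul_add, mul_assoc]
  module

theorem abs_A2_a (a b : R) (h : F) (ha : a * a = h • a + 1) (hb : b * b = h • b + 1) :
    (a * b * a - b * a * b) * a = (h • 1 - b) * (a * b * a - b * a * b) := by
  have e1 : a * b * a * a = a * b * (a * a) := by noncomm_ring
  have e2 : b * (b * a * b) = (b * b) * a * b := by noncomm_ring
  rw [sub_mul, e1, sub_mul, mul_sub b, e2, ha, hb]
  simp only [mul_sub, sub_mul, mul_add, add_mul, mul_smul_comm, smul_mul_assoc, mul_one, one_mul,
    smul_sub, mul_assoc]
  module

theorem abs_B2_a (a b : R) (h h' : F) (ha : a * a = h • a + 1) (hb : b * b = h' • b + 1) :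
    (a * b * a * b - b * a * b * a) * a = (h • 1 - a) * (a * b * a * b - b * a * b * a) := by
  have e1 : b * a * b * a * a = b * a * b * (a * a) := by noncomm_ring
  have e2 : a * (a * b * a * b) = (a * a) * b * a * b := by noncomm_ring
  rw [sub_mul, e1, sub_mul, mul_sub a, e2, ha]
  simp only [mul_sub, sub_mul, mul_add, add_mul, mul_smul_comm, smul_mul_assoc, mul_one, one_mul,
    smul_sub, mul_assoc]
  module

theorem abs_B2_x (a b x1 x2 x1' x2' : R) (h h' g : F) (ha : a * a = h • a + 1)
    (hb : b * b = h' • b + 1)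
    (c1 : a * x1 = x2 * (a - h • 1)) (c2 : a * x2' = x1' * (a - h • 1))
    (c3 : b * x2 = x2' * (b - h' • 1) - g • 1)
    (c4 : b * x1 = x1 * b) (c5 : b * x1' = x1' * b) :
    (a * b * a * b - b * a * b * a) * x1 = x1' * (a * b * a * b - b * a * b * a) := by
  have haa : a * (a - h • 1) = 1 := by
    rw [mul_sub, ha, mul_smul_comm, mul_one]; abel
  have e1 : a * b * a * b * x1
      = x1' * ((a - h • 1) * (b - h' • 1) * (a - h • 1) * b) - g • b := by
    calc a * b * a * b * x1 = a * b * a * (b * x1) := by noncomm_ring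
      _ = a * b * (a * x1) * b := by rw [c4]; noncomm_ring
      _ = a * (b * x2) * ((a - h • 1) * b) := by rw [c1]; noncomm_ring
      _ = (a * x2') * ((b - h' • 1) * (a - h • 1) * b) - g • ((a * (a - h • 1)) * b) := by
          rw [c3]
          simp only [mul_sub, sub_mul, mul_smul_comm, smul_mul_assoc, mul_one, one_mul, smul_sub,
            mul_assoc]
          module
      _ = _ := by
          rw [c2, haa, one_mul]
          simp only [mul_assoc]
  have e2 : b * a * b * a * x1
      = x1' * (b * (a - h • 1) * (b - h' • 1) * (a - h • 1)) - g • b := by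
    calc b * a * b * a * x1 = b * a * b * (a * x1) := by noncomm_ring
      _ = b * a * (b * x2) * (a - h • 1) := by rw [c1]; noncomm_ring
      _ = b * (a * x2') * ((b - h' • 1) * (a - h • 1)) - g • (b * (a * (a - h • 1))) := by
          rw [c3]
          simp only [mul_sub, sub_mul, mul_smul_comm, smul_mul_assoc, mul_one, one_mul, smul_sub,
            mul_assoc]
          module
      _ = (b * x1') * ((a - h • 1) * (b - h' • 1) * (a - h • 1)) - g • b := by
          rw [c2, haa, mul_one]
          simp only [mul_assoc]
      _ = _ := by
          rw [c5]
          simp only [mul_assoc]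
  rw [sub_mul, e1, e2, sub_sub_sub_cancel_right, ← mul_sub]
  congr 1
  have ha2 : ∀ z, a * (a * z) = h • (a * z) + z := by
    intro z; rw [← mul_assoc, ha, add_mul, one_mul, smul_mul_assoc]
  have hb2 : ∀ z, b * (b * z) = h' • (b * z) + z := by
    intro z; rw [← mul_assoc, hb, add_mul, one_mul, smul_mul_assoc]
  simp only [mul_sub, sub_mul, mul_smul_comm, smul_mul_assoc, mul_one, one_mul, smul_sub, ha, hb,
    smul_add, mul_assoc, mul_add, add_mul, ha2, hb2]
  module

theorem abs_conj (a x1 x2 : R) (h : F) (ha : a * a = h • a + 1)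
    (c1 : a * x1 = x2 * (a - h • 1)) : x2 = a * x1 * a := by
  rw [c1, mul_assoc, sub_mul, ha]
  simp

theorem abs_conj_inv (a x1 x2 x1' x2' : R) (h : F) (ha : a * a = h • a + 1)
    (c1 : a * x2' = x1' * (a - h • 1)) : x2' = (a - h • 1) * x1' * (a - h • 1) := by
  rw [mul_assoc, ← c1, ← mul_assoc, sub_mul, ha]
  simp

theorem abs_quadA (a x x2 : R) (h : F) (c1 : a * x = x2 * (a - h • 1))
    (c2 : a * x2 = x * a + h • x2) :
    (a * a - h • a - 1) * x = x * (a * a - h • a - 1) := by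
  have e1 : a * a * x = (x * a + h • x2) * (a - h • 1) := by
    rw [mul_assoc, c1, ← mul_assoc, c2]
  rw [sub_mul, sub_mul, e1, smul_mul_assoc, c1]
  simp only [mul_sub, sub_mul, add_mul, mul_smul_comm, smul_mul_assoc, mul_one, one_mul, smul_sub,
    mul_assoc]
  module

theorem abs_quadB (b x x' : R) (h g : F) (c1 : b * x = x' * (b - h • 1) - g • 1)
    (c2 : b * x' = x * b + h • x' + g • 1) :
    (b * b - h • b - 1) * x = x * (b * b - h • b - 1) := by
  have e1 : b * b * x = (x * b + h • x' + g • 1) * (b - h • 1) - g • b := by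
    rw [mul_assoc, c1, mul_sub, ← mul_assoc, c2, mul_smul_comm, mul_one]
  rw [sub_mul, sub_mul, e1, smul_mul_assoc, c1]
  simp only [mul_sub, sub_mul, add_mul, mul_smul_comm, smul_mul_assoc, mul_one, one_mul, smul_sub,
    mul_assoc]
  module

end abstract

/-! ### Values of the rank one operators near the origin -/

/-- coefficient of the type `A` operator on dominant monomials -/
def kA (k : F) (s : ℝ) : F := if s = 0 then k else if s = 1 then k⁻¹ else 1

/-- coefficient of the type `B` operator on dominant monomials -/
def kB (k u : F) (s : ℝ) : F := if s = 0 then k else if s = 1 / 2 then u⁻¹ else 1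

theorem kA_ne (k : F) (hk : k ≠ 0) (s : ℝ) : kA k s ≠ 0 := by
  unfold kA
  split_ifs <;> simp [hk]

theorem kB_ne (k u : F) (hk : k ≠ 0) (hu : u ≠ 0) (s : ℝ) : kB k u s ≠ 0 := by
  unfold kB
  split_ifs <;> simp [hk, hu]

theorem Aop_dom (p : E r →ₗ[ℝ] ℝ) (v : E r) (k : F) (y : E r) (h0 : 0 ≤ p y) (h1 : p y ≤ 1) :
    Aop F r p v k (X F r y) = kA k (p y) • X F r (y - p y • v) := by
  rw [Aop_X]
  unfold Ael kA
  rcases h0.eq_or_lt with h | h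
  · rw [← h]; simp [chiZ_zero, geomS_zero]
  rcases h1.eq_or_lt with h' | h'
  · rw [h', chiZ_one, Int.floor_one, geomS_neg_one]
    simp only [one_ne_zero, if_false, if_true, inv_one, one_smul, pow_one, neg_mul, X_mul]
    rw [show -v + y = y - v by abel]
    module
  · have hf : ⌊p y⌋ = 0 := by rw [Int.floor_eq_zero_iff]; exact ⟨h0, h'⟩
    rw [hf, chiZ_between (p y) 0 (by simpa using h) (by simpa using h'), if_neg h.ne', if_neg h'.ne]
    simp [geomS_zero]

theorem Aop_neg (p : E r →ₗ[ℝ] ℝ) (v : E r) (k : F) (y : E r) (h0 : -1 < p y) (h1 : p y < 0) :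
    Aop F r p v k (X F r y) = X F r (y - p y • v) + (k - k⁻¹) • X F r y := by
  rw [Aop_X]
  unfold Ael
  have hf : ⌊p y⌋ = -1 := by rw [Int.floor_eq_iff]; push_cast; constructor <;> linarith
  rw [hf, chiZ_between (p y) (-1) (by simpa using h0) (by simpa using h1), neg_neg, geomS_one]
  simp

theorem Bop_dom (l : E r →ₗ[ℝ] ℝ) (w : E r) (c k u : F) (ψ : ℝ → F) (hc : c ≠ 0)
    (h2 : ψ (1 / 2) = c⁻¹) (y : E r) (h0 : 0 ≤ l y) (h1 : l y ≤ 1 / 2) :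
    Bop F r l w c k u ψ (X F r y) = (kB k u (l y) * ψ (l y)) • X F r (y - (2 * l y) • w) := by
  rw [Bop_X]
  unfold Bel kB
  rcases h0.eq_or_lt with h | h
  · rw [← h, chiZ_zero, chiZ_between (0 + 1 / 2) 0 (by norm_num) (by norm_num)]
    have : ⌊(0 + 1 / 2 : ℝ)⌋ = 0 := by rw [Int.floor_eq_zero_iff]; constructor <;> norm_num
    rw [this]
    simp [geomS_zero]
  have hf : ⌊l y⌋ = 0 := by rw [Int.floor_eq_zero_iff]; constructor <;> linarith
  rw [hf, chiZ_between (l y) 0 (by simpa using h) (by push_cast; linarith), if_neg h.ne']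
  rcases h1.eq_or_lt with h' | h'
  · rw [h', h2]
    have e : (1 / 2 + 1 / 2 : ℝ) = 1 := by norm_num
    rw [e, chiZ_one, Int.floor_one, geomS_neg_one, neg_zero, geomS_zero, if_pos rfl]
    simp only [X_mul, pow_zero, pow_one, one_mul, zero_mul, smul_zero, add_zero, mul_neg, neg_mul,
      smul_mul_assoc, mul_smul_comm]
    have e1 : w + -((2 : ℝ) • w) + y = y - (2 * (1 / 2 : ℝ)) • w := by module
    have e2 : (c * c)⁻¹ * c = c⁻¹ := by field_simp
    rw [e1, smul_smul, e2]
    module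
  · have hf' : ⌊l y + 1 / 2⌋ = 0 := by rw [Int.floor_eq_zero_iff]; constructor <;> linarith
    rw [hf', chiZ_between (l y + 1 / 2) 0 (by push_cast; linarith) (by push_cast; linarith),
      if_neg h'.ne]
    simp [geomS_zero]

theorem Bop_neg (l : E r →ₗ[ℝ] ℝ) (w : E r) (c k u : F) (ψ : ℝ → F) (y : E r)
    (h0 : -(1 / 2) ≤ l y) (h1 : l y < 0) :
    Bop F r l w c k u ψ (X F r y)
      = (u ^ chiZ (l y + 1 / 2) * ψ (l y)) • X F r (y - (2 * l y) • w) + (k - k⁻¹) • X F r y := by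
  rw [Bop_X]
  unfold Bel
  have hf : ⌊l y⌋ = -1 := by rw [Int.floor_eq_iff]; push_cast; constructor <;> linarith
  have hf' : ⌊l y + 1 / 2⌋ = 0 := by rw [Int.floor_eq_zero_iff]; constructor <;> linarith
  rw [hf, hf', chiZ_between (l y) (-1) (by push_cast; linarith) (by push_cast; linarith), neg_neg,
    geomS_one, neg_zero, geomS_zero]
  simp

theorem shift_mem (K : Submodule F (QA F r)) (c : F) (hc : c ≠ 0) (la : E r)
    (h1 : ∀ f ∈ K, mulX F r c la f ∈ K) (h2 : ∀ f ∈ K, mulX F r c⁻¹ (-la) f ∈ K)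
    (n : ℤ) (y : E r) (h : X F r (y + (n : ℝ) • la) ∈ K) : X F r y ∈ K := by
  have h1' : ∀ z, X F r z ∈ K → X F r (z + la) ∈ K := by
    intro z hz
    have := K.smul_mem c⁻¹ (h1 _ hz)
    rwa [mulX_X, smul_smul, inv_mul_cancel₀ hc, one_smul, add_comm] at this
  have h2' : ∀ z, X F r z ∈ K → X F r (z - la) ∈ K := by
    intro z hz
    have := K.smul_mem c (h2 _ hz)
    rwa [mulX_X, smul_smul, mul_inv_cancel₀ hc, one_smul, neg_add_eq_sub] at this
  induction n using Int.induction_on with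
  | zero => simpa using h
  | succ n ih =>
    apply ih
    have := h2' _ h
    convert this using 2
    push_cast
    module
  | pred n ih =>
    apply ih
    have := h1' _ h
    convert this using 2
    push_cast
    module

theorem ker_stab {D x z : Module.End F (QA F r)} (h : D * x = z * D) (f : QA F r)
    (hf : f ∈ LinearMap.ker D) : x f ∈ LinearMap.ker D := by
  rw [LinearMap.mem_ker] at *
  have := congrArg (fun T : Module.End F (QA F r) => T f) h
  simp only [Module.End.mul_apply] at this
  rw [this, hf, map_zero]

theorem ker_stab_inv {D x z x' z' : Module.End F (QA F r)} (h : D * x = z * D) (hx : x * x' = 1)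
    (hz : z' * z = 1) (f : QA F r)
    (hf : f ∈ LinearMap.ker D) : x' f ∈ LinearMap.ker D := by
  have : D * x' = z' * D := by
    calc D * x' = (z' * z) * D * x' := by rw [hz, one_mul]
      _ = z' * (z * D) * x' := by noncomm_ring
      _ = z' * D * (x * x') := by rw [← h]; noncomm_ring
      _ = _ := by rw [hx, mul_one]
  exact ker_stab this f hf

theorem Aop_quad (p : E r →ₗ[ℝ] ℝ) (v : E r) (k : F) (hk : k ≠ 0) (hv : p v = 2) (la : E r)
    (hla : p la = 1) :
    Aop F r p v k * Aop F r p v k = (k - k⁻¹) • Aop F r p v k + 1 := by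
  set a := Aop F r p v k with ha
  suffices hQ : a * a - (k - k⁻¹) • a - 1 = 0 by
    rw [← sub_eq_zero, ← hQ]; abel
  have c1 := Aop_cross_one p v k la hla
  have c2 := Aop_cross_neg_one p v k (la - v) (by rw [map_sub, hla, hv]; norm_num)
  rw [sub_add_cancel] at c2
  have hcomm := abs_quadA _ _ _ _ c1 c2
  rw [← ha] at hcomm
  apply end_ext
  intro y
  rw [LinearMap.zero_apply, ← LinearMap.mem_ker]
  apply shift_mem _ 1 one_ne_zero la (fun f hf => ker_stab hcomm f hf)
    (fun f hf => ker_stab_inv hcomm (mulX_inv F r 1 one_ne_zero la) (mulX_inv' F r 1 one_ne_zero la)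
      f hf) (-⌊p y⌋) y
  set z := y + ((-⌊p y⌋ : ℤ) : ℝ) • la with hz
  have hpz : p z = Int.fract (p y) := by
    rw [hz, map_add, map_smul, hla, smul_eq_mul]; push_cast
    linarith [Int.self_sub_floor (p y)]
  have h0 : 0 ≤ p z := by rw [hpz]; exact Int.fract_nonneg _
  have h1 : p z < 1 := by rw [hpz]; exact Int.fract_lt_one _
  rw [LinearMap.mem_ker]
  simp only [LinearMap.sub_apply, Module.End.mul_apply, LinearMap.smul_apply, Module.End.one_apply]
  rw [ha, Aop_dom p v k z h0 h1.le]
  rcases h0.eq_or_lt with h | h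
  · rw [← h, zero_smul, sub_zero, map_smul, Aop_dom p v k z h0 h1.le, ← h, zero_smul, sub_zero]
    have : kA k 0 = k := by simp [kA]
    rw [this]
    match_scalars
    field_simp
    ring
  · have hk1 : kA k (p z) = 1 := by simp [kA, h.ne', h1.ne]
    have hs : p (z - p z • v) = - p z := by rw [map_sub, map_smul, hv]; simp; ring
    rw [hk1, one_smul, Aop_neg p v k _ (by rw [hs]; linarith) (by rw [hs]; linarith), hs]
    have : z - p z • v - -p z • v = z := by module
    rw [this]
    abel

theorem Bop_quad (l : E r →ₗ[ℝ] ℝ) (w : E r) (c k u : F) (ψ : ℝ → F) (hc : c ≠ 0) (hk : k ≠ 0)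
    (hu : u ≠ 0) (hw : l w = 1) (hψ : ∀ s, ψ (s + 1) = c⁻¹ * c⁻¹ * ψ s)
    (hψn : ∀ s, ψ (-s) * ψ s = 1) (hψ0 : ψ 0 = 1) (hψ2 : ψ (1 / 2) = c⁻¹) :
    Bop F r l w c k u ψ * Bop F r l w c k u ψ = (k - k⁻¹) • Bop F r l w c k u ψ + 1 := by
  set a := Bop F r l w c k u ψ with ha
  suffices hQ : a * a - (k - k⁻¹) • a - 1 = 0 by
    rw [← sub_eq_zero, ← hQ]; abel
  have c1 := Bop_cross l w c k u ψ hc hw hψ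
  have c2 := Bop_cross_inv l w c k u ψ hc hw hψ
  have hcomm := abs_quadB _ _ _ _ _ c1 c2
  rw [← ha] at hcomm
  apply end_ext
  intro y
  rw [LinearMap.zero_apply, ← LinearMap.mem_ker]
  apply shift_mem _ c hc w (fun f hf => ker_stab hcomm f hf)
    (fun f hf => ker_stab_inv hcomm (mulX_inv F r c hc w) (mulX_inv' F r c hc w)
      f hf) (-⌊l y + 1 / 2⌋) y
  set z := y + ((-⌊l y + 1 / 2⌋ : ℤ) : ℝ) • w with hz
  have hpz : l z = Int.fract (l y + 1 / 2) - 1 / 2 := by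
    rw [hz, map_add, map_smul, hw, smul_eq_mul]; push_cast
    linarith [Int.self_sub_floor (l y + 1 / 2)]
  have h0 : -(1 / 2) ≤ l z := by rw [hpz]; linarith [Int.fract_nonneg (l y + 1 / 2)]
  have h1 : l z < 1 / 2 := by rw [hpz]; linarith [Int.fract_lt_one (l y + 1 / 2)]
  have hs : l (z - (2 * l z) • w) = - l z := by rw [map_sub, map_smul, hw]; simp; ring
  have hss : z - (2 * l z) • w - (2 * (-l z)) • w = z := by module
  rw [LinearMap.mem_ker]
  simp only [LinearMap.sub_apply, Module.End.mul_apply, LinearMap.smul_apply, Module.End.one_apply]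
  rcases lt_trichotomy (l z) 0 with h | h | h
  · rw [ha, Bop_neg l w c k u ψ z h0 h, map_add, map_smul, map_smul, Bop_neg l w c k u ψ z h0 h,
      Bop_dom l w c k u ψ hc hψ2 (z - (2 * l z) • w) (by rw [hs]; linarith) (by rw [hs]; linarith),
      hs, hss]
    have hkk : u ^ chiZ (l z + 1 / 2) * ψ (l z) * (kB k u (-l z) * ψ (-l z)) = 1 := by
      have : u ^ chiZ (l z + 1 / 2) * kB k u (-l z) = 1 := by
        rcases h0.eq_or_lt with h' | h'
        · rw [← h']
          have : (-(1 / 2) + 1 / 2 : ℝ) = 0 := by norm_num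
          rw [this, chiZ_zero]
          simp [kB, hu]
        · rw [chiZ_between (l z + 1 / 2) 0 (by push_cast; linarith) (by push_cast; linarith)]
          have e1 : -l z ≠ 0 := by linarith
          have e2 : -l z ≠ 1 / 2 := by linarith
          unfold kB
          rw [if_neg e1, if_neg e2]
          simp
      linear_combination ψ (-l z) * ψ (l z) * this + hψn (l z)
    rw [smul_smul, hkk]
    module
  · have e : a (X F r z) = k • X F r z := by
      rw [ha, Bop_dom l w c k u ψ hc hψ2 z h.ge (by linarith), h, hψ0]
      simp [kB]
    rw [e, map_smul, e]
    match_scalars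
    field_simp
    ring
  · rw [ha, Bop_dom l w c k u ψ hc hψ2 z h.le h1.le, map_smul, Bop_neg l w c k u ψ
      (z - (2 * l z) • w) (by rw [hs]; linarith) (by rw [hs]; linarith), hs, hss]
    have e1 : kB k u (l z) = 1 := by simp [kB, h.ne']; intro hh; exfalso; linarith
    rw [chiZ_between (-l z + 1 / 2) 0 (by push_cast; linarith) (by push_cast; linarith), e1]
    have := hψn (l z)
    match_scalars
    · linear_combination this
    · ring



/-! ### Rank two braid relations -/

theorem abs_A2_b {R : Type*} [Ring R] [Algebra F R] (a b : R) (h : F) (ha : a * a = h • a + 1)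
    (hb : b * b = h • b + 1) :
    (a * b * a - b * a * b) * b = (h • 1 - a) * (a * b * a - b * a * b) := by
  have := abs_A2_a b a h hb ha
  have e : b * a * b - a * b * a = -(a * b * a - b * a * b) := by abel
  rw [e, neg_mul, mul_neg, neg_inj] at this
  exact this

theorem abs_B2_b {R : Type*} [Ring R] [Algebra F R] (a b : R) (h h' : F)
    (ha : a * a = h • a + 1) (hb : b * b = h' • b + 1) :
    (a * b * a * b - b * a * b * a) * b = (h' • 1 - b) * (a * b * a * b - b * a * b * a) := by
  have := abs_B2_a b a h' h hb ha
  have e : b * a * b * a - a * b * a * b = -(a * b * a * b - b * a * b * a) := by abel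
  rw [e, neg_mul, mul_neg, neg_inj] at this
  exact this

theorem Aop_move (l1 l2 : E r →ₗ[ℝ] ℝ) (w1 w2 : E r) (k : F) (z : E r) (h0 : l2 z ≤ l1 z)
    (h1 : l1 z - l2 z ≤ 1) :
    Aop F r (l1 - l2) (w1 - w2) k (X F r z)
      = kA k (l1 z - l2 z) • X F r (z - (l1 z - l2 z) • (w1 - w2)) := by
  have := Aop_dom (l1 - l2) (w1 - w2) k z (by rw [LinearMap.sub_apply]; linarith)
    (by rw [LinearMap.sub_apply]; linarith)
  rwa [LinearMap.sub_apply] at this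

/-- bubble sort step, type `A` -/
theorem A_refl_mem (K : Submodule F (QA F r)) (l1 l2 : E r →ₗ[ℝ] ℝ) (w1 w2 : E r) (k : F)
    (hk : k ≠ 0) (h11 : l1 w1 = 1) (h12 : l1 w2 = 0) (h21 : l2 w1 = 0) (h22 : l2 w2 = 1)
    (hK : ∀ f ∈ K, Aop F r (l1 - l2) (w1 - w2) k f ∈ K) (y : E r) (h0 : l1 y ≤ l2 y)
    (h1 : l2 y - l1 y ≤ 1) (hy : X F r (y - (l1 y - l2 y) • (w1 - w2)) ∈ K) : X F r y ∈ K := by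
  set z := y - (l1 y - l2 y) • (w1 - w2) with hz
  have e1 : l1 z = l2 y := by
    rw [hz, map_sub, map_smul, map_sub, h11, h12, smul_eq_mul]; ring
  have e2 : l2 z = l1 y := by
    rw [hz, map_sub, map_smul, map_sub, h21, h22, smul_eq_mul]; ring
  have h := hK _ hy
  rw [Aop_move l1 l2 w1 w2 k z (by rw [e1, e2]; exact h0) (by rw [e1, e2]; exact h1), e1, e2] at h
  have e3 : z - (l2 y - l1 y) • (w1 - w2) = y := by rw [hz]; module
  rw [e3] at h
  have := K.smul_mem (kA k (l2 y - l1 y))⁻¹ h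
  rwa [smul_smul, inv_mul_cancel₀ (kA_ne k hk _), one_smul] at this

/-- bubble sort step, type `B` -/
theorem B_refl_mem (K : Submodule F (QA F r)) (l : E r →ₗ[ℝ] ℝ) (w : E r) (c k u : F) (ψ : ℝ → F)
    (hc : c ≠ 0) (hk : k ≠ 0) (hu : u ≠ 0) (hw : l w = 1) (hψn : ∀ s, ψ (-s) * ψ s = 1)
    (hψ2 : ψ (1 / 2) = c⁻¹) (hK : ∀ f ∈ K, Bop F r l w c k u ψ f ∈ K) (y : E r)
    (h0 : l y ≤ 0) (h1 : -(1 / 2) ≤ l y) (hy : X F r (y - (2 * l y) • w) ∈ K) : X F r y ∈ K := by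
  set z := y - (2 * l y) • w with hz
  have e1 : l z = -l y := by
    rw [hz, map_sub, map_smul, hw, smul_eq_mul]; ring
  have h := hK _ hy
  rw [Bop_dom l w c k u ψ hc hψ2 z (by rw [e1]; linarith) (by rw [e1]; linarith), e1] at h
  have e3 : z - (2 * -l y) • w = y := by rw [hz]; module
  rw [e3] at h
  have hne : kB k u (-l y) * ψ (-l y) ≠ 0 :=
    mul_ne_zero (kB_ne k u hk hu _) (left_ne_zero_of_mul_eq_one (hψn _))
  have := K.smul_mem (kB k u (-l y) * ψ (-l y))⁻¹ h
  rwa [smul_smul, inv_mul_cancel₀ hne, one_smul] at this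

theorem Aop_cross_one_c (p : E r →ₗ[ℝ] ℝ) (v : E r) (k c : F) (la : E r) (h : p la = 1) :
    Aop F r p v k * mulX F r c la = mulX F r c (la - v) * (Aop F r p v k - (k - k⁻¹) • 1) := by
  have e : ∀ z, mulX F r c z = c • mulX F r 1 z := by
    intro z
    apply end_ext
    intro y
    simp [mulX_X]
  rw [e, e, mul_smul_comm, Aop_cross_one p v k la h, smul_mul_assoc]

theorem A2_dom (l1 l2 l3 : E r →ₗ[ℝ] ℝ) (w1 w2 w3 : E r) (k : F)
    (h11 : l1 w1 = 1) (h12 : l1 w2 = 0) (h13 : l1 w3 = 0)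
    (h21 : l2 w1 = 0) (h22 : l2 w2 = 1) (h23 : l2 w3 = 0)
    (h31 : l3 w1 = 0) (h32 : l3 w2 = 0) (h33 : l3 w3 = 1) (z : E r)
    (d1 : l2 z ≤ l1 z) (d2 : l3 z ≤ l2 z) (d3 : l1 z - l3 z ≤ 1) :
    (Aop F r (l1 - l2) (w1 - w2) k * Aop F r (l2 - l3) (w2 - w3) k * Aop F r (l1 - l2) (w1 - w2) k)
      (X F r z)
    = (Aop F r (l2 - l3) (w2 - w3) k * Aop F r (l1 - l2) (w1 - w2) k *
        Aop F r (l2 - l3) (w2 - w3) k) (X F r z) := by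
  simp only [Module.End.mul_apply]
  have A := Aop_move (F := F) (r := r) l1 l2 w1 w2 k
  have B := Aop_move (F := F) (r := r) l2 l3 w2 w3 k
  have ev : ∀ (y : E r) (s : ℝ), l1 (y - s • (w1 - w2)) = l1 y - s ∧
      l2 (y - s • (w1 - w2)) = l2 y + s ∧ l3 (y - s • (w1 - w2)) = l3 y ∧
      l1 (y - s • (w2 - w3)) = l1 y ∧ l2 (y - s • (w2 - w3)) = l2 y - s ∧
      l3 (y - s • (w2 - w3)) = l3 y + s := by
    intro y s
    simp [h11, h12, h13, h21, h22, h23, h31, h32, h33]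
  rw [A z d1 (by linarith), B z d2 (by linarith)]
  simp only [map_smul]
  rw [B _ (by simp only [ev]; linarith) (by simp only [ev]; linarith),
    A _ (by simp only [ev]; linarith) (by simp only [ev]; linarith)]
  simp only [map_smul]
  rw [A _ (by simp only [ev]; linarith) (by simp only [ev]; linarith),
    B _ (by simp only [ev]; linarith) (by simp only [ev]; linarith)]
  simp only [ev, smul_smul]
  congr 1
  · ring_nf
  · congr 1
    module

theorem A2_braid (l1 l2 l3 : E r →ₗ[ℝ] ℝ) (w1 w2 w3 : E r) (k : F) (hk : k ≠ 0)
    (h11 : l1 w1 = 1) (h12 : l1 w2 = 0) (h13 : l1 w3 = 0)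
    (h21 : l2 w1 = 0) (h22 : l2 w2 = 1) (h23 : l2 w3 = 0)
    (h31 : l3 w1 = 0) (h32 : l3 w2 = 0) (h33 : l3 w3 = 1) :
    Aop F r (l1 - l2) (w1 - w2) k * Aop F r (l2 - l3) (w2 - w3) k * Aop F r (l1 - l2) (w1 - w2) k
    = Aop F r (l2 - l3) (w2 - w3) k * Aop F r (l1 - l2) (w1 - w2) k *
        Aop F r (l2 - l3) (w2 - w3) k := by
  have hdom := A2_dom l1 l2 l3 w1 w2 w3 k h11 h12 h13 h21 h22 h23 h31 h32 h33
  have ev : ∀ (y : E r) (s : ℝ), l1 (y - s • (w1 - w2)) = l1 y - s ∧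
      l2 (y - s • (w1 - w2)) = l2 y + s ∧ l3 (y - s • (w1 - w2)) = l3 y ∧
      l1 (y - s • (w2 - w3)) = l1 y ∧ l2 (y - s • (w2 - w3)) = l2 y - s ∧
      l3 (y - s • (w2 - w3)) = l3 y + s := by
    intro y s
    simp [h11, h12, h13, h21, h22, h23, h31, h32, h33]
  have qa := Aop_quad (F := F) (l1 - l2) (w1 - w2) k hk (by simp [h11, h12, h21, h22]; norm_num) w1
    (by simp [h11, h21])
  have qb := Aop_quad (F := F) (l2 - l3) (w2 - w3) k hk (by simp [h22, h23, h32, h33]; norm_num) w2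
    (by simp [h22, h32])
  have ca1 := Aop_cross_one (F := F) (l1 - l2) (w1 - w2) k w1 (by simp [h11, h21])
  have cb2 := Aop_cross_one (F := F) (l2 - l3) (w2 - w3) k w2 (by simp [h22, h32])
  have ca1' := Aop_cross_one (F := F) (l1 - l2) (w1 - w2) k (-w2) (by simp [h12, h22])
  have cb2' := Aop_cross_one (F := F) (l2 - l3) (w2 - w3) k (-w3) (by simp [h23, h33])
  have cb1 := Aop_cross_zero (F := F) (l2 - l3) (w2 - w3) k 1 w1 (by simp [h21, h31])
  have ca3 := Aop_cross_zero (F := F) (l1 - l2) (w1 - w2) k 1 w3 (by simp [h13, h23])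
  rw [sub_sub_cancel] at ca1 cb2
  have e1 : -w2 - (w1 - w2) = -w1 := by abel
  have e2 : -w3 - (w2 - w3) = -w2 := by abel
  rw [e1] at ca1'
  rw [e2] at cb2'
  have Ra := fun K => A_refl_mem (F := F) (r := r) K l1 l2 w1 w2 k hk h11 h12 h21 h22
  have Rb := fun K => A_refl_mem (F := F) (r := r) K l2 l3 w2 w3 k hk h22 h23 h32 h33
  set a := Aop F r (l1 - l2) (w1 - w2) k with ha
  set b := Aop F r (l2 - l3) (w2 - w3) k with hb
  rw [← sub_eq_zero]
  set D := a * b * a - b * a * b with hD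
  have Da : D * a = ((k - k⁻¹) • 1 - b) * D := abs_A2_a a b _ qa qb
  have Db : D * b = ((k - k⁻¹) • 1 - a) * D := by
    exact abs_A2_b a b _ qa qb
  have Dx : D * mulX F r 1 w1 = mulX F r 1 w3 * D := abs_A2_x a b _ _ _ _ qa qb ca1 cb2 cb1 ca3
  have Ka : ∀ f ∈ LinearMap.ker D, a f ∈ LinearMap.ker D := fun f hf => ker_stab Da f hf
  have Kb : ∀ f ∈ LinearMap.ker D, b f ∈ LinearMap.ker D := fun f hf => ker_stab Db f hf
  have Kah : ∀ f ∈ LinearMap.ker D, (a - (k - k⁻¹) • 1) f ∈ LinearMap.ker D := fun f hf =>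
    Submodule.sub_mem _ (Ka f hf) (Submodule.smul_mem _ _ hf)
  have Kbh : ∀ f ∈ LinearMap.ker D, (b - (k - k⁻¹) • 1) f ∈ LinearMap.ker D := fun f hf =>
    Submodule.sub_mem _ (Kb f hf) (Submodule.smul_mem _ _ hf)
  have K1 : ∀ f ∈ LinearMap.ker D, mulX F r 1 w1 f ∈ LinearMap.ker D := fun f hf =>
    ker_stab Dx f hf
  have K1' : ∀ f ∈ LinearMap.ker D, mulX F r 1 (-w1) f ∈ LinearMap.ker D := fun f hf => by
    have := ker_stab_inv Dx (mulX_inv F r 1 one_ne_zero w1) (mulX_inv' F r 1 one_ne_zero w3) f hf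
    rwa [inv_one] at this
  have K2 : ∀ f ∈ LinearMap.ker D, mulX F r 1 w2 f ∈ LinearMap.ker D := fun f hf => by
    rw [abs_conj a _ _ _ qa ca1]; exact Ka _ (K1 _ (Ka _ hf))
  have K2' : ∀ f ∈ LinearMap.ker D, mulX F r 1 (-w2) f ∈ LinearMap.ker D := fun f hf => by
    rw [abs_conj_inv a 0 0 _ _ _ qa ca1']; exact Kah _ (K1' _ (Kah _ hf))
  have K3 : ∀ f ∈ LinearMap.ker D, mulX F r 1 w3 f ∈ LinearMap.ker D := fun f hf => by
    rw [abs_conj b _ _ _ qb cb2]; exact Kb _ (K2 _ (Kb _ hf))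
  have K3' : ∀ f ∈ LinearMap.ker D, mulX F r 1 (-w3) f ∈ LinearMap.ker D := fun f hf => by
    rw [abs_conj_inv b 0 0 _ _ _ qb cb2']; exact Kbh _ (K2' _ (Kbh _ hf))
  have Ra := Ra (LinearMap.ker D) Ka
  have Rb := Rb (LinearMap.ker D) Kb
  -- dominant case and bubble sort
  have cl1 : ∀ z, 0 ≤ l3 z → l3 z ≤ l2 z → l2 z ≤ l1 z → l1 z ≤ 1 → X F r z ∈ LinearMap.ker D := by
    intro z g1 g2 g3 g4
    rw [LinearMap.mem_ker, hD, LinearMap.sub_apply, sub_eq_zero]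
    exact hdom z g3 g2 (by linarith)
  have cl2 : ∀ z, 0 ≤ l3 z → 0 ≤ l2 z → l2 z ≤ l1 z → l3 z ≤ l1 z → l1 z ≤ 1 →
      X F r z ∈ LinearMap.ker D := by
    intro z g1 g2 g3 g4 g5
    by_cases hc : l3 z ≤ l2 z
    · exact cl1 z g1 hc g3 g5
    · refine Rb z (by linarith) (by linarith) (cl1 _ ?_ ?_ ?_ ?_) <;> simp only [ev] <;> linarith
  have cl3 : ∀ z, 0 ≤ l3 z → 0 ≤ l2 z → l3 z ≤ l1 z → l1 z ≤ 1 → l2 z ≤ 1 →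
      X F r z ∈ LinearMap.ker D := by
    intro z g1 g2 g3 g4 g5
    by_cases hc : l2 z ≤ l1 z
    · exact cl2 z g1 g2 hc g3 g4
    · refine Ra z (by linarith) (by linarith) (cl2 _ ?_ ?_ ?_ ?_ ?_) <;> simp only [ev] <;> linarith
  have cl4 : ∀ z, 0 ≤ l3 z → 0 ≤ l1 z → l3 z ≤ l2 z → l1 z ≤ 1 → l2 z ≤ 1 →
      X F r z ∈ LinearMap.ker D := by
    intro z g1 g2 g3 g4 g5
    by_cases hc : l3 z ≤ l1 z
    · exact cl3 z g1 (by linarith) hc g4 g5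
    · refine Ra z (by linarith) (by linarith) (cl3 _ ?_ ?_ ?_ ?_ ?_) <;> simp only [ev] <;> linarith
  have cl5 : ∀ z, 0 ≤ l1 z → 0 ≤ l2 z → 0 ≤ l3 z → l1 z ≤ 1 → l2 z ≤ 1 → l3 z ≤ 1 →
      X F r z ∈ LinearMap.ker D := by
    intro z g1 g2 g3 g4 g5 g6
    by_cases hc : l3 z ≤ l2 z
    · exact cl4 z g3 g1 hc g4 g5
    · refine Rb z (by linarith) (by linarith) (cl4 _ ?_ ?_ ?_ ?_ ?_) <;> simp only [ev] <;> linarith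
  apply end_ext
  intro y
  rw [LinearMap.zero_apply, ← LinearMap.mem_ker]
  have i1 : (1 : F)⁻¹ = 1 := inv_one
  apply shift_mem _ 1 one_ne_zero w1 K1 (by rw [i1]; exact K1') (-⌊l1 y⌋) y
  apply shift_mem _ 1 one_ne_zero w2 K2 (by rw [i1]; exact K2') (-⌊l2 y⌋)
  apply shift_mem _ 1 one_ne_zero w3 K3 (by rw [i1]; exact K3') (-⌊l3 y⌋)
  have f1 := Int.floor_le (l1 y)
  have f2 := Int.floor_le (l2 y)
  have f3 := Int.floor_le (l3 y)
  have f1' := Int.lt_floor_add_one (l1 y)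
  have f2' := Int.lt_floor_add_one (l2 y)
  have f3' := Int.lt_floor_add_one (l3 y)
  apply cl5 <;> simp only [map_add, map_smul, h11, h12, h13, h21, h22, h23, h31, h32, h33,
    smul_eq_mul] <;> push_cast <;> linarith

theorem BC2_dom (l1 l2 : E r →ₗ[ℝ] ℝ) (w1 w2 : E r) (k c k' u : F) (ψ : ℝ → F) (hc : c ≠ 0)
    (h11 : l1 w1 = 1) (h12 : l1 w2 = 0) (h21 : l2 w1 = 0) (h22 : l2 w2 = 1)
    (hψ2 : ψ (1 / 2) = c⁻¹) (z : E r)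
    (d1 : l2 z ≤ l1 z) (d2 : 0 ≤ l2 z) (d3 : l1 z ≤ 1 / 2) :
    (Aop F r (l1 - l2) (w1 - w2) k * Bop F r l2 w2 c k' u ψ * Aop F r (l1 - l2) (w1 - w2) k *
      Bop F r l2 w2 c k' u ψ) (X F r z)
    = (Bop F r l2 w2 c k' u ψ * Aop F r (l1 - l2) (w1 - w2) k * Bop F r l2 w2 c k' u ψ *
      Aop F r (l1 - l2) (w1 - w2) k) (X F r z) := by
  simp only [Module.End.mul_apply]
  have A := Aop_move (F := F) (r := r) l1 l2 w1 w2 k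
  have B := Bop_dom (F := F) (r := r) l2 w2 c k' u ψ hc hψ2
  have ev : ∀ (y : E r) (s : ℝ), l1 (y - s • (w1 - w2)) = l1 y - s ∧
      l2 (y - s • (w1 - w2)) = l2 y + s ∧ l1 (y - s • w2) = l1 y ∧ l2 (y - s • w2) = l2 y - s := by
    intro y s
    simp [h11, h12, h21, h22]
  rw [A z d1 (by linarith), B z d2 (by linarith)]
  simp only [map_smul]
  rw [B _ (by simp only [ev]; linarith) (by simp only [ev]; linarith),
    A _ (by simp only [ev]; linarith) (by simp only [ev]; linarith)]
  simp only [map_smul]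
  rw [A _ (by simp only [ev]; linarith) (by simp only [ev]; linarith),
    B _ (by simp only [ev]; linarith) (by simp only [ev]; linarith)]
  simp only [map_smul]
  rw [A _ (by simp only [ev]; linarith) (by simp only [ev]; linarith),
    B _ (by simp only [ev]; linarith) (by simp only [ev]; linarith)]
  simp only [ev, smul_smul]
  ring_nf

theorem BC2_braid (l1 l2 : E r →ₗ[ℝ] ℝ) (w1 w2 : E r) (k c k' u : F) (ψ : ℝ → F) (hc : c ≠ 0)
    (hk : k ≠ 0) (hk' : k' ≠ 0) (hu : u ≠ 0)
    (h11 : l1 w1 = 1) (h12 : l1 w2 = 0) (h21 : l2 w1 = 0) (h22 : l2 w2 = 1)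
    (hψ : ∀ s, ψ (s + 1) = c⁻¹ * c⁻¹ * ψ s)
    (hψn : ∀ s, ψ (-s) * ψ s = 1) (hψ0 : ψ 0 = 1) (hψ2 : ψ (1 / 2) = c⁻¹) :
    Aop F r (l1 - l2) (w1 - w2) k * Bop F r l2 w2 c k' u ψ * Aop F r (l1 - l2) (w1 - w2) k *
      Bop F r l2 w2 c k' u ψ
    = Bop F r l2 w2 c k' u ψ * Aop F r (l1 - l2) (w1 - w2) k * Bop F r l2 w2 c k' u ψ *
      Aop F r (l1 - l2) (w1 - w2) k := by
  have hdom := BC2_dom l1 l2 w1 w2 k c k' u ψ hc h11 h12 h21 h22 hψ2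
  have ev : ∀ (y : E r) (s : ℝ), l1 (y - s • (w1 - w2)) = l1 y - s ∧
      l2 (y - s • (w1 - w2)) = l2 y + s ∧ l1 (y - s • w2) = l1 y ∧ l2 (y - s • w2) = l2 y - s := by
    intro y s
    simp [h11, h12, h21, h22]
  have qa := Aop_quad (F := F) (l1 - l2) (w1 - w2) k hk (by simp [h11, h12, h21, h22]; norm_num) w1
    (by simp [h11, h21])
  have qb := Bop_quad (F := F) l2 w2 c k' u ψ hc hk' hu h22 hψ hψn hψ0 hψ2
  have c1 := Aop_cross_one_c (F := F) (l1 - l2) (w1 - w2) k c w1 (by simp [h11, h21])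
  have c2 := Aop_cross_one_c (F := F) (l1 - l2) (w1 - w2) k c⁻¹ (-w2) (by simp [h12, h22])
  have c3 := Bop_cross (F := F) l2 w2 c k' u ψ hc h22 hψ
  have c4 := Bop_cross_zero (F := F) l2 w2 c k' u c ψ w1 h21
  have c5 := Bop_cross_zero (F := F) l2 w2 c k' u c⁻¹ ψ (-w1) (by simp [h21])
  rw [sub_sub_cancel] at c1
  have e1 : -w2 - (w1 - w2) = -w1 := by abel
  rw [e1] at c2
  have Ra := fun K => A_refl_mem (F := F) (r := r) K l1 l2 w1 w2 k hk h11 h12 h21 h22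
  have Rb := fun K => B_refl_mem (F := F) (r := r) K l2 w2 c k' u ψ hc hk' hu h22 hψn hψ2
  set a := Aop F r (l1 - l2) (w1 - w2) k with ha
  set b := Bop F r l2 w2 c k' u ψ with hb
  rw [← sub_eq_zero]
  set D := a * b * a * b - b * a * b * a with hD
  have Da : D * a = ((k - k⁻¹) • 1 - a) * D := abs_B2_a a b _ _ qa qb
  have Db : D * b = ((k' - k'⁻¹) • 1 - b) * D := by
    exact abs_B2_b a b _ _ qa qb
  have Dx : D * mulX F r c w1 = mulX F r c⁻¹ (-w1) * D :=
    abs_B2_x a b _ _ _ _ _ _ _ qa qb c1 c2 c3 c4 c5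
  have Ka : ∀ f ∈ LinearMap.ker D, a f ∈ LinearMap.ker D := fun f hf => ker_stab Da f hf
  have Kb : ∀ f ∈ LinearMap.ker D, b f ∈ LinearMap.ker D := fun f hf => ker_stab Db f hf
  have Kah : ∀ f ∈ LinearMap.ker D, (a - (k - k⁻¹) • 1) f ∈ LinearMap.ker D := fun f hf =>
    Submodule.sub_mem _ (Ka f hf) (Submodule.smul_mem _ _ hf)
  have K1 : ∀ f ∈ LinearMap.ker D, mulX F r c w1 f ∈ LinearMap.ker D := fun f hf =>
    ker_stab Dx f hf
  have K1' : ∀ f ∈ LinearMap.ker D, mulX F r c⁻¹ (-w1) f ∈ LinearMap.ker D := fun f hf =>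
    ker_stab_inv Dx (mulX_inv F r c hc w1) (mulX_inv F r c hc w1) f hf
  have K2 : ∀ f ∈ LinearMap.ker D, mulX F r c w2 f ∈ LinearMap.ker D := fun f hf => by
    rw [abs_conj a _ _ _ qa c1]; exact Ka _ (K1 _ (Ka _ hf))
  have K2' : ∀ f ∈ LinearMap.ker D, mulX F r c⁻¹ (-w2) f ∈ LinearMap.ker D := fun f hf => by
    rw [abs_conj_inv a 0 0 _ _ _ qa c2]; exact Kah _ (K1' _ (Kah _ hf))
  have Ra := Ra (LinearMap.ker D) Ka
  have Rb := Rb (LinearMap.ker D) Kb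
  have cl1 : ∀ z, 0 ≤ l2 z → l2 z ≤ l1 z → l1 z ≤ 1 / 2 → X F r z ∈ LinearMap.ker D := by
    intro z g1 g2 g3
    rw [LinearMap.mem_ker, hD, LinearMap.sub_apply, sub_eq_zero]
    exact hdom z g2 g1 g3
  have cl2 : ∀ z, 0 ≤ l2 z → 0 ≤ l1 z → l1 z ≤ 1 / 2 → l2 z ≤ 1 / 2 →
      X F r z ∈ LinearMap.ker D := by
    intro z g1 g2 g3 g4
    by_cases hc : l2 z ≤ l1 z
    · exact cl1 z g1 hc g3
    · refine Ra z (by linarith) (by linarith) (cl1 _ ?_ ?_ ?_) <;> simp only [ev] <;> linarith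
  have cl3 : ∀ z, -(1 / 2) ≤ l2 z → 0 ≤ l1 z → l1 z ≤ 1 / 2 → l2 z ≤ 1 / 2 →
      X F r z ∈ LinearMap.ker D := by
    intro z g1 g2 g3 g4
    by_cases hc : 0 ≤ l2 z
    · exact cl2 z hc g2 g3 g4
    · refine Rb z (by linarith) (by linarith) (cl2 _ ?_ ?_ ?_ ?_) <;> simp only [ev] <;> linarith
  have cl4 : ∀ z, 0 ≤ l2 z → -(1 / 2) ≤ l1 z → l1 z ≤ 1 / 2 → l2 z ≤ 1 / 2 →
      X F r z ∈ LinearMap.ker D := by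
    intro z g1 g2 g3 g4
    by_cases hc : 0 ≤ l1 z
    · exact cl2 z g1 hc g3 g4
    · refine Ra z (by linarith) (by linarith) (cl3 _ ?_ ?_ ?_ ?_) <;> simp only [ev] <;> linarith
  have cl5 : ∀ z, -(1 / 2) ≤ l2 z → -(1 / 2) ≤ l1 z → l1 z ≤ 1 / 2 → l2 z ≤ 1 / 2 →
      X F r z ∈ LinearMap.ker D := by
    intro z g1 g2 g3 g4
    by_cases hc : 0 ≤ l2 z
    · exact cl4 z hc g2 g3 g4
    · refine Rb z (by linarith) (by linarith) (cl4 _ ?_ ?_ ?_ ?_) <;> simp only [ev] <;> linarith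
  apply end_ext
  intro y
  rw [LinearMap.zero_apply, ← LinearMap.mem_ker]
  apply shift_mem _ c hc w1 K1 K1' (-⌊l1 y + 1 / 2⌋) y
  apply shift_mem _ c hc w2 K2 K2' (-⌊l2 y + 1 / 2⌋)
  have f1 := Int.floor_le (l1 y + 1 / 2)
  have f2 := Int.floor_le (l2 y + 1 / 2)
  have f1' := Int.lt_floor_add_one (l1 y + 1 / 2)
  have f2' := Int.lt_floor_add_one (l2 y + 1 / 2)
  apply cl5 <;> simp only [map_add, map_smul, h11, h12, h21, h22,
    smul_eq_mul] <;> push_cast <;> linarith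



/-! ### Commutation of orthogonal rank one operators -/

/-- rank one operators -/
def Rk1 (T : Module.End F (QA F r)) (p : E r →ₗ[ℝ] ℝ) (v : E r) : Prop :=
  ∃ (κ : ℝ → F) (σ : ℝ → ℝ) (H : ℝ → QA F r),
    (∀ y, T (X F r y) = κ (p y) • X F r (y - σ (p y) • v) + H (p y) * X F r y) ∧
    ∀ s (S : Module.End F (QA F r)), (∀ f, S (X F r v * f) = X F r v * S f) →
      ∀ f, S (H s * f) = H s * S f

theorem Rk1_shift {T : Module.End F (QA F r)} {p : E r →ₗ[ℝ] ℝ} {v : E r} (hT : Rk1 T p v)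
    (la : E r) (h : p la = 0) (f : QA F r) : T (X F r la * f) = X F r la * T f := by
  obtain ⟨κ, σ, H, h1, -⟩ := hT
  have : T * mulX F r 1 la = mulX F r 1 la * T := by
    apply end_ext
    intro y
    simp only [Module.End.mul_apply, mulX_apply, one_smul, X_mul, h1, map_add, h, zero_add]
    rw [mul_smul_comm, X_mul, mul_left_comm, X_mul, add_sub_assoc]
  have := congrArg (fun S : Module.End F (QA F r) => S f) this
  simpa [Module.End.mul_apply, mulX_apply] using this

theorem Rk1_comm {T S : Module.End F (QA F r)} {p p' : E r →ₗ[ℝ] ℝ} {v v' : E r} (hT : Rk1 T p v)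
    (hS : Rk1 S p' v') (h : p v' = 0) (h' : p' v = 0) : T * S = S * T := by
  have a1 := Rk1_shift hT v' h
  have a2 := Rk1_shift hS v h'
  obtain ⟨κ, σ, H, h1, h2⟩ := hT
  obtain ⟨κ', σ', H', h1', h2'⟩ := hS
  apply end_ext
  intro y
  have e1 : ∀ s : ℝ, p (y - s • v') = p y := by intro s; simp [h]
  have e2 : ∀ s : ℝ, p' (y - s • v) = p' y := by intro s; simp [h']
  simp only [Module.End.mul_apply]
  rw [h1 y, h1' y]
  simp only [map_add, map_smul]
  rw [h2 _ S a2, h2' _ T a1, h1, h1', h1 y, h1' y, e1, e2,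
    show y - σ' (p' y) • v' - σ (p y) • v = y - σ (p y) • v - σ' (p' y) • v' by abel]
  simp only [Algebra.smul_def]
  ring

theorem Aop_Rk1 (p : E r →ₗ[ℝ] ℝ) (v : E r) (k : F) : Rk1 (Aop F r p v k) p v := by
  refine ⟨fun s => k ^ chiZ s, fun s => s, fun s => (k - k⁻¹) • geomS F r 1 v (-⌊s⌋), ?_, ?_⟩
  · intro y
    rw [Aop_X, Ael, smul_mul_assoc]
  · intro s S hS f
    rw [smul_mul_assoc, map_smul, geomS_comm F r S 1 one_ne_zero v hS, smul_mul_assoc]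

theorem Bop_Rk1 (l : E r →ₗ[ℝ] ℝ) (w : E r) (c k u : F) (ψ : ℝ → F) (hc : c ≠ 0) :
    Rk1 (Bop F r l w c k u ψ) l w := by
  refine ⟨fun s => k ^ chiZ s * u ^ chiZ (s + 1 / 2) * ψ s, fun s => 2 * s,
    fun s => (k - k⁻¹) • geomS F r (c * c) ((2 : ℝ) • w) (-⌊s⌋) +
      (u - u⁻¹) • ((c • X F r w) * geomS F r (c * c) ((2 : ℝ) • w) (-⌊s + 1 / 2⌋)), ?_, ?_⟩
  · intro y
    rw [Bop_X, Bel]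
    simp only [add_mul, smul_mul_assoc, add_assoc]
  · intro s S hS f
    have h2 : ∀ f, S (X F r ((2 : ℝ) • w) * f) = X F r ((2 : ℝ) • w) * S f := by
      intro f
      have : X F r ((2 : ℝ) • w) = X F r w * X F r w := by rw [X_mul, two_smul]
      rw [this, mul_assoc, hS, hS, mul_assoc]
    have h3 := geomS_comm F r S (c * c) (mul_ne_zero hc hc) ((2 : ℝ) • w) h2
    simp only [add_mul, smul_mul_assoc, map_add, map_smul, mul_assoc, h3, hS]

/-! ### Stability of `F[O]` -/

theorem geomS_mem (K : Submodule F (QA F r)) (c : F) (v : E r)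
    (h1 : ∀ f ∈ K, X F r v * f ∈ K) (h2 : ∀ f ∈ K, X F r (-v) * f ∈ K) (m : ℤ) (f : QA F r)
    (hf : f ∈ K) : geomS F r c v m * f ∈ K := by
  have hX : ∀ n : ℤ, X F r ((n : ℝ) • v) * f ∈ K := by
    intro n
    induction n using Int.induction_on with
    | zero => simpa [X_zero] using hf
    | succ n ih =>
      have := h1 _ ih
      rw [← mul_assoc, X_mul] at this
      convert this using 3
      push_cast
      module
    | pred n ih =>
      have := h2 _ ih
      rw [← mul_assoc, X_mul] at this
      convert this using 3
      push_cast
      module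
  induction m using Int.induction_on with
  | zero => simp [geomS_zero]
  | succ n ih =>
    rw [geomS_succ, add_mul, smul_mul_assoc]
    exact K.add_mem ih (K.smul_mem _ (hX _))
  | pred n ih =>
    have := geomS_succ F r c v (-n - 1)
    rw [sub_add_cancel] at this
    rw [← sub_eq_iff_eq_add] at this
    rw [← this, sub_mul, smul_mul_assoc]
    exact K.sub_mem ih (K.smul_mem _ (hX _))

theorem FO_X {O : Set (E r)} {y : E r} (hy : y ∈ O) : X F r y ∈ FO F r O :=
  Submodule.subset_span ⟨y, hy, rfl⟩

theorem FO_map {O : Set (E r)} (T : Module.End F (QA F r))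
    (h : ∀ y ∈ O, T (X F r y) ∈ FO F r O) : ∀ f ∈ FO F r O, T f ∈ FO F r O := by
  intro f hf
  have : FO F r O ≤ (FO F r O).comap T := by
    apply Submodule.span_le.2
    rintro _ ⟨y, hy, rfl⟩
    exact h y hy
  exact this hf

theorem FO_mulX {O : Set (E r)} (v : E r) (h : ∀ y ∈ O, v + y ∈ O) :
    ∀ f ∈ FO F r O, X F r v * f ∈ FO F r O := by
  intro f hf
  have := FO_map (mulX F r 1 v) (O := O)
    (by intro y hy; rw [mulX_X, one_smul]; exact FO_X (h y hy)) f hf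
  rwa [mulX_apply, one_smul] at this

theorem Aop_FO {O : Set (E r)} (p : E r →ₗ[ℝ] ℝ) (v : E r) (k : F)
    (h1 : ∀ y ∈ O, y - p y • v ∈ O) (h2 : ∀ y ∈ O, v + y ∈ O) (h3 : ∀ y ∈ O, -v + y ∈ O) :
    ∀ f ∈ FO F r O, Aop F r p v k f ∈ FO F r O := by
  apply FO_map
  intro y hy
  rw [Aop_X, Ael]
  exact Submodule.add_mem _ (Submodule.smul_mem _ _ (FO_X (h1 y hy)))
    (Submodule.smul_mem _ _ (geomS_mem _ _ _ (FO_mulX v h2) (FO_mulX (-v) h3) _ _ (FO_X hy)))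

theorem Bop_FO {O : Set (E r)} (l : E r →ₗ[ℝ] ℝ) (w : E r) (c k u : F) (ψ : ℝ → F)
    (h1 : ∀ y ∈ O, y - (2 * l y) • w ∈ O) (h2 : ∀ y ∈ O, w + y ∈ O) (h3 : ∀ y ∈ O, -w + y ∈ O) :
    ∀ f ∈ FO F r O, Bop F r l w c k u ψ f ∈ FO F r O := by
  apply FO_map
  intro y hy
  have h4 : ∀ y ∈ O, (2 : ℝ) • w + y ∈ O := by
    intro y hy
    rw [two_smul, add_assoc]; exact h2 _ (h2 _ hy)
  have h5 : ∀ y ∈ O, -((2 : ℝ) • w) + y ∈ O := by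
    intro y hy
    rw [two_smul, neg_add, add_assoc]; exact h3 _ (h3 _ hy)
  have h6 := fun m => geomS_mem (FO F r O) (c * c) ((2 : ℝ) • w) (FO_mulX _ h4) (FO_mulX _ h5) m _
    (FO_X hy)
  rw [Bop_X, Bel]
  refine Submodule.add_mem _ (Submodule.add_mem _ (Submodule.smul_mem _ _ (FO_X (h1 y hy)))
    (Submodule.smul_mem _ _ (h6 _))) (Submodule.smul_mem _ _ ?_)
  rw [smul_mul_assoc, smul_mul_assoc, mul_assoc]
  exact Submodule.smul_mem _ _ (FO_mulX w h2 _ (h6 _))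

/-- two operators agreeing on monomials in `O` agree on `F[O]` -/
theorem FO_eq {O : Set (E r)} (T S : Module.End F (QA F r))
    (h : ∀ y ∈ O, T (X F r y) = S (X F r y)) : ∀ f ∈ FO F r O, T f = S f := by
  intro f hf
  have : FO F r O ≤ LinearMap.ker (T - S) := by
    apply Submodule.span_le.2
    rintro _ ⟨y, hy, rfl⟩
    simp [h y hy]
  have := this hf
  rwa [LinearMap.mem_ker, LinearMap.sub_apply, sub_eq_zero] at this

theorem hecke_of_quad (T : Module.End F (QA F r)) (k : F) (hk : k ≠ 0)
    (h : T * T = (k - k⁻¹) • T + 1) : (T - k • 1) * (T + k⁻¹ • 1) = 0 := by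
  rw [sub_mul, mul_add, mul_add, h]
  simp only [mul_smul_comm, smul_mul_assoc, mul_one, one_mul, smul_smul]
  rw [inv_mul_cancel₀ hk]
  module



/-! ### Identification of the concrete operators -/

theorem cd_succ (y : E r) (m : Fin r) : cd r y ((m : ℕ) + 1) = y m := by
  unfold cd
  rw [Finset.sum_eq_single m]
  · simp
  · intro b _ hb
    rw [if_neg]
    intro h
    exact hb (Fin.ext (by omega))
  · simp

theorem epsV_succ (m : Fin r) : epsV r ((m : ℕ) + 1) = eV r m := by
  funext n
  unfold epsV eV
  congr 1
  apply propext
  rw [Fin.ext_iff]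
  omega

theorem eV_self (m : Fin r) : eV r m m = 1 := by simp [eV]

theorem eV_ne {m n : Fin r} (h : n ≠ m) : eV r m n = 0 := by simp [eV, h]

theorem chiE_two (s : ℝ) : chiE (2 * s) = chiZ s := by
  unfold chiE chiZ
  congr 1
  apply propext
  constructor
  · rintro ⟨n, hn⟩; exact ⟨n, by linarith⟩
  · rintro ⟨n, hn⟩; exact ⟨n, by linarith⟩

theorem chiO_two (s : ℝ) : chiO (2 * s) = chiZ (s + 1 / 2) := by
  unfold chiO chiZ
  congr 1
  apply propext
  constructor
  · rintro ⟨n, hn⟩; exact ⟨n + 1, by push_cast; linarith⟩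
  · rintro ⟨n, hn⟩; exact ⟨n - 1, by push_cast; linarith⟩

theorem chiZ_half_neg (s : ℝ) : chiZ (-s + 1 / 2) = chiZ (s + 1 / 2) := by
  unfold chiZ
  congr 1
  apply propext
  constructor
  · rintro ⟨n, hn⟩; exact ⟨1 - n, by push_cast; linarith⟩
  · rintro ⟨n, hn⟩; exact ⟨1 - n, by push_cast; linarith⟩

theorem floorE_two (z s : ℝ) (h : z = 2 * s) : -floorE z / 2 = -⌊s⌋ := by
  subst h
  unfold floorE
  rw [mul_div_cancel_left₀ s (two_ne_zero)]
  omega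

theorem floorO_two (z s : ℝ) (h : z = 2 * s) : (-floorO z - 1) / 2 = -⌊s + 1 / 2⌋ := by
  subst h
  unfold floorO
  have : (2 * s + 1) / 2 = s + 1 / 2 := by ring
  rw [this]
  omega

theorem sW_A (i j : Fin r) (hj : (j : ℕ) = i + 1) (y : E r) :
    sW r ((i : ℕ) + 1) y = y - (y i - y j) • (eV r i - eV r j) := by
  have hne : (i : ℕ) + 1 ≠ r := by have := j.2; omega
  have hij : i ≠ j := by intro h; rw [Fin.ext_iff] at h; omega
  funext m
  unfold sW
  rw [if_neg hne]
  simp only [Pi.sub_apply, Pi.smul_apply, smul_eq_mul]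
  by_cases h1 : m = i
  · subst h1
    rw [if_pos rfl, eV_self, eV_ne hij, ← hj, cd_succ]
    ring
  · rw [if_neg (fun h => h1 (Fin.ext (by omega))), eV_ne h1]
    by_cases h2 : m = j
    · subst h2
      rw [if_pos hj, eV_self, cd_succ]
      ring
    · rw [if_neg (fun h => h2 (Fin.ext (by omega))), eV_ne h2]
      ring

theorem sW_B (n : Fin r) (hn : (n : ℕ) + 1 = r) (y : E r) :
    sW r r y = y - (2 * y n) • eV r n := by
  funext m
  unfold sW
  rw [if_pos rfl]
  simp only [Pi.sub_apply, Pi.smul_apply, smul_eq_mul]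
  by_cases h1 : m = n
  · subst h1
    rw [if_pos hn, eV_self]
    ring
  · rw [if_neg (fun h => h1 (Fin.ext (by omega))), eV_ne h1]
    ring

theorem sEps1_eq (n : Fin r) (hn : (n : ℕ) = 0) (y : E r) :
    sEps1 r y = y - (2 * y n) • eV r n := by
  funext m
  unfold sEps1
  simp only [Pi.sub_apply, Pi.smul_apply, smul_eq_mul]
  by_cases h1 : m = n
  · subst h1
    rw [if_pos hn, eV_self]
    ring
  · rw [if_neg (fun h => h1 (Fin.ext (by omega))), eV_ne h1]
    ring

/-- coordinate functional -/
def pr (m : Fin r) : E r →ₗ[ℝ] ℝ := LinearMap.proj m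

theorem pr_apply (m : Fin r) (y : E r) : pr m y = y m := rfl

theorem pr_self (m : Fin r) : pr m (eV r m) = 1 := eV_self m

theorem pr_ne {m n : Fin r} (h : n ≠ m) : pr n (eV r m) = 0 := eV_ne h

theorem Top_A (k kr ur : F) (i j : Fin r) (hj : (j : ℕ) = i + 1) :
    Top F r k kr ur ((i : ℕ) + 1) = Aop F r (pr i - pr j) (eV r i - eV r j) k := by
  have hne : (i : ℕ) + 1 ≠ r := by have := j.2; omega
  apply end_ext
  intro y
  rw [Aop_X, Top, mkOp_X, Tel, if_neg hne, Ael, nablaIel, sW_A i j hj, epsV_succ, ← hj, epsV_succ,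
    cd_succ, hj, cd_succ]
  rfl

theorem Top_B (k kr ur : F) (n : Fin r) (hn : (n : ℕ) + 1 = r) :
    Top F r k kr ur r = Bop F r (pr n) (eV r n) 1 kr ur (fun _ => 1) := by
  apply end_ext
  intro y
  have e1 : cd r y r = y n := by rw [← cd_succ y n, hn]
  have e2 : epsV r r = eV r n := by rw [← epsV_succ n, hn]
  rw [Bop_X, Top, mkOp_X, Tel, if_pos rfl, Bel, nablaReEl, nablaRoEl, e1, e2, sW_B n hn, chiE_two,
    chiO_two, floorE_two _ _ rfl, floorO_two _ _ rfl]
  simp only [pr_apply, mul_one, one_smul]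

theorem T0_eq (qh : Fˣ) (k0 u0 : F) (t : Fin r → Fˣ) (ψ : ℝ → F) (n : Fin r) (hn : (n : ℕ) = 0)
    (y : E r) (h : ((tcU F r (torusAct F r qh (gfun r y) t) 1 : Fˣ) : F) = ψ (y n)) :
    T0op F r qh k0 u0 t (X F r y)
      = Bop F r (-pr n) (-eV r n) qh k0 u0 (fun s => ψ (-s)) (X F r y) := by
  have e1 : cd r y 1 = y n := by rw [← cd_succ y n, hn]
  have e2 : epsV r 1 = eV r n := by rw [← epsV_succ n, hn]
  rw [Bop_X, T0op, mkOp_X, T0el, Bel, nabla0eEl, nabla0oEl, e1, e2, sEps1_eq n hn, chiE_two,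
    chiO_two, floorE_two (-2 * y n) (-y n) (by ring), floorO_two (-2 * y n) (-y n) (by ring), h]
  have e3 : (-pr n) y = - y n := rfl
  have e4 : y - (2 * -y n) • -eV r n = y - (2 * y n) • eV r n := by module
  have e5 : (2 : ℝ) • -eV r n = (-2 : ℝ) • eV r n := by module
  have e6 : -eV r n = (-1 : ℝ) • eV r n := by module
  rw [e3, e4, e5, chiZ_neg, chiZ_half_neg, neg_neg, e6]



/-! ### Words in the affine Weyl group -/

/-- affine signed permutations with integral translation part -/
def IsAff (g : E r → E r) (ε : Fin r → ℤ) (σ : Equiv.Perm (Fin r)) (lam : Fin r → ℤ) : Prop :=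
  (∀ m, ε m = 1 ∨ ε m = -1) ∧ ∀ z m, g z m = ε m * z (σ m) + lam m

theorem genF_zero (n : Fin r) (hn : (n : ℕ) = 0) (y : E r) :
    genF r 0 y = Function.update y n (1 - y n) := by
  funext m
  unfold genF
  rw [if_pos rfl]
  by_cases h : m = n
  · subst h; simp [hn]
  · rw [Function.update_of_ne h]
    rw [if_neg (fun h' => h (Fin.ext (by omega)))]

theorem genF_last (hr : 2 ≤ r) (n : Fin r) (hn : (n : ℕ) + 1 = r) (y : E r) :
    genF r r y = Function.update y n (- y n) := by
  unfold genF
  rw [if_neg (by omega), sW_B n hn]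
  funext m
  by_cases h : m = n
  · subst h; simp [eV_self]; ring
  · rw [Function.update_of_ne h]; simp [eV_ne h]

theorem genF_mid (i j : Fin r) (hj : (j : ℕ) = i + 1) (y : E r) :
    genF r ((i : ℕ) + 1) y = y ∘ Equiv.swap i j := by
  unfold genF
  rw [if_neg (by omega), sW_A i j hj]
  have hij : i ≠ j := by intro h; rw [Fin.ext_iff] at h; omega
  funext m
  simp only [Pi.sub_apply, Pi.smul_apply, smul_eq_mul, Function.comp]
  by_cases h1 : m = i
  · subst h1; rw [Equiv.swap_apply_left, eV_self, eV_ne hij]; ring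
  by_cases h2 : m = j
  · subst h2; rw [Equiv.swap_apply_right, eV_self, eV_ne h1]; ring
  · rw [Equiv.swap_apply_of_ne_of_ne h1 h2, eV_ne h1, eV_ne h2]; ring

theorem gen_cases (hr : 2 ≤ r) (j : ℕ) (hj : j ≤ r) :
    j = 0 ∨ j = r ∨ ∃ a b : Fin r, (b : ℕ) = a + 1 ∧ j = a + 1 := by
  by_cases h0 : j = 0
  · exact Or.inl h0
  by_cases h1 : j = r
  · exact Or.inr (Or.inl h1)
  · exact Or.inr (Or.inr ⟨⟨j - 1, by omega⟩, ⟨j, by omega⟩, by simp; omega, by simp; omega⟩)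

theorem gen_invol (hr : 2 ≤ r) (j : ℕ) (hj : j ≤ r) (y : E r) : genF r j (genF r j y) = y := by
  rcases gen_cases hr j hj with rfl | rfl | ⟨a, b, hb, rfl⟩
  · rw [genF_zero ⟨0, by omega⟩ rfl, genF_zero ⟨0, by omega⟩ rfl]; simp
  · rw [genF_last hr ⟨j - 1, by omega⟩ (by simp; omega), genF_last hr ⟨j - 1, by omega⟩
      (by simp; omega)]; simp
  · rw [genF_mid a b hb, genF_mid a b hb]
    funext m; simp

theorem gen_aff (hr : 2 ≤ r) (j : ℕ) (hj : j ≤ r) : ∃ ε σ lam, IsAff (genF r j) ε σ lam := by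
  rcases gen_cases hr j hj with rfl | rfl | ⟨a, b, hb, rfl⟩
  · set n : Fin r := ⟨0, by omega⟩
    refine ⟨fun m => if m = n then -1 else 1, 1, fun m => if m = n then 1 else 0, ?_, ?_⟩
    · intro m; by_cases h : m = n <;> simp [h]
    · intro z m
      rw [genF_zero n rfl]
      by_cases h : m = n
      · subst h; simp; ring
      · simp [h]
  · set n : Fin j := ⟨j - 1, by omega⟩ with hn
    refine ⟨fun m => if m = n then -1 else 1, 1, fun m => 0, ?_, ?_⟩
    · intro m; by_cases h : m = n <;> simp [h]
    · intro z m
      rw [genF_last hr n (by simp [hn]; omega)]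
      by_cases h : m = n
      · subst h; simp
      · simp [h]
  · refine ⟨fun m => 1, Equiv.swap a b, fun m => 0, fun m => Or.inl rfl, ?_⟩
    intro z m
    rw [genF_mid a b hb]
    simp

theorem word_aff (hr : 2 ≤ r) (l : List ℕ) (hl : ∀ a ∈ l, a ≤ r) :
    ∃ ε σ lam, IsAff (wordAct r l) ε σ lam := by
  induction l with
  | nil => exact ⟨fun _ => 1, 1, fun _ => 0, fun _ => Or.inl rfl, by intro z m; simp [wordAct]⟩
  | cons a l ih =>
    obtain ⟨ε', σ', lam', h1', h2'⟩ := ih (fun b hb => hl b (List.mem_cons_of_mem _ hb))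
    obtain ⟨ε, σ, lam, h1, h2⟩ := gen_aff hr a (hl a List.mem_cons_self)
    refine ⟨fun m => ε m * ε' (σ m), σ' * σ, fun m => ε m * lam' (σ m) + lam m, ?_, ?_⟩
    · intro m
      rcases h1 m with h | h <;> rcases h1' (σ m) with h' | h' <;> simp [h, h']
    · intro z m
      have : wordAct r (a :: l) z = genF r a (wordAct r l z) := rfl
      rw [this, h2, h2']
      push_cast
      simp only [Equiv.Perm.coe_mul, Function.comp]
      ring

theorem wordAct_append (l l' : List ℕ) (y : E r) :
    wordAct r (l ++ l') y = wordAct r l (wordAct r l' y) := by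
  unfold wordAct; rw [List.foldr_append]

theorem word_rev (hr : 2 ≤ r) (l : List ℕ) (hl : ∀ a ∈ l, a ≤ r) (y : E r) :
    wordAct r l (wordAct r l.reverse y) = y := by
  induction l generalizing y with
  | nil => rfl
  | cons a l ih =>
    rw [List.reverse_cons, wordAct_append]
    have e1 : ∀ z, wordAct r (a :: l) z = genF r a (wordAct r l z) := fun _ => rfl
    rw [e1, ih (fun b hb => hl b (List.mem_cons_of_mem _ hb))]
    exact gen_invol hr a (hl a List.mem_cons_self) y

/-! ### Sets closed under the generators -/

theorem clos_perm {S : Set (E r)} (hS : ∀ j ≤ r, ∀ y ∈ S, genF r j y ∈ S)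
    (σ : Equiv.Perm (Fin r)) : ∀ y ∈ S, y ∘ σ ∈ S := by
  cases r with
  | zero => intro y hy; convert hy
  | succ n =>
    have hσ : σ ∈ Submonoid.closure (Set.range fun i : Fin n => Equiv.swap i.castSucc i.succ) := by
      rw [Equiv.Perm.mclosure_swap_castSucc_succ]; trivial
    induction hσ using Submonoid.closure_induction with
    | mem x hx =>
      obtain ⟨i, rfl⟩ := hx
      intro y hy
      have := hS (i + 1) (by have := i.2; omega) y hy
      have h2 := genF_mid i.castSucc i.succ (by simp) y
      simp only [Fin.val_castSucc] at h2
      rw [h2] at this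
      exact this
    | one => intro y hy; exact hy
    | mul a b _ _ iha ihb =>
      intro y hy
      have := ihb _ (iha y hy)
      exact this

theorem conj_update (y : E r) (m n : Fin r) (g : ℝ → ℝ) :
    (Function.update (y ∘ Equiv.swap m n) n (g ((y ∘ Equiv.swap m n) n))) ∘ Equiv.swap m n
      = Function.update y m (g (y m)) := by
  funext i
  by_cases h : i = m
  · subst h; simp
  · have : Equiv.swap m n i ≠ n := by
      intro h'
      apply h
      have := congrArg (Equiv.swap m n) h'
      simpa using this
    simp [Function.update_of_ne h, Function.update_of_ne this]

theorem clos_neg (hr : 2 ≤ r) {S : Set (E r)} (hS : ∀ j ≤ r, ∀ y ∈ S, genF r j y ∈ S)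
    (m : Fin r) : ∀ y ∈ S, Function.update y m (- y m) ∈ S := by
  intro y hy
  set n : Fin r := ⟨r - 1, by omega⟩ with hn
  rw [← conj_update y m n (fun s => -s)]
  apply clos_perm hS
  have := hS r le_rfl _ (clos_perm hS (Equiv.swap m n) y hy)
  rwa [genF_last hr n (by simp [hn]; omega)] at this

theorem clos_refl (hr : 2 ≤ r) {S : Set (E r)} (hS : ∀ j ≤ r, ∀ y ∈ S, genF r j y ∈ S)
    (m : Fin r) : ∀ y ∈ S, Function.update y m (1 - y m) ∈ S := by
  intro y hy
  set n : Fin r := ⟨0, by omega⟩ with hn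
  rw [← conj_update y m n (fun s => 1 - s)]
  apply clos_perm hS
  have := hS 0 (by omega) _ (clos_perm hS (Equiv.swap m n) y hy)
  rwa [genF_zero n (by simp [hn])] at this

theorem clos_add (hr : 2 ≤ r) {S : Set (E r)} (hS : ∀ j ≤ r, ∀ y ∈ S, genF r j y ∈ S)
    (m : Fin r) : ∀ y ∈ S, Function.update y m (y m + 1) ∈ S := by
  intro y hy
  have := clos_refl hr hS m _ (clos_neg hr hS m y hy)
  rw [Function.update_self, Function.update_idem] at this
  convert this using 2
  ring

theorem clos_sub (hr : 2 ≤ r) {S : Set (E r)} (hS : ∀ j ≤ r, ∀ y ∈ S, genF r j y ∈ S)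
    (m : Fin r) : ∀ y ∈ S, Function.update y m (y m - 1) ∈ S := by
  intro y hy
  have := clos_neg hr hS m _ (clos_refl hr hS m y hy)
  rw [Function.update_self, Function.update_idem] at this
  convert this using 2
  ring

theorem clos_int (hr : 2 ≤ r) {S : Set (E r)} (hS : ∀ j ≤ r, ∀ y ∈ S, genF r j y ∈ S)
    (m : Fin r) (n : ℤ) : ∀ y ∈ S, Function.update y m (y m + n) ∈ S := by
  induction n using Int.induction_on with
  | zero => intro y hy; simpa using hy
  | succ n ih =>
    intro y hy
    have := clos_add hr hS m _ (ih y hy)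
    rw [Function.update_self, Function.update_idem] at this
    convert this using 2
    push_cast; ring
  | pred n ih =>
    intro y hy
    have := clos_sub hr hS m _ (ih y hy)
    rw [Function.update_self, Function.update_idem] at this
    convert this using 2
    push_cast; ring

theorem clos_alcove (hr : 2 ≤ r) {S : Set (E r)} (hS : ∀ j ≤ r, ∀ y ∈ S, genF r j y ∈ S)
    (hne : S.Nonempty) : ∃ c ∈ S, c ∈ CplusCl r := by
  have h1 : ∀ s : Finset (Fin r), ∃ z ∈ S, ∀ m ∈ s, 0 ≤ z m ∧ z m ≤ 1 / 2 := by
    intro s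
    induction s using Finset.induction_on with
    | empty => obtain ⟨y, hy⟩ := hne; exact ⟨y, hy, by simp⟩
    | insert a s ha ih =>
      obtain ⟨z, hz, h⟩ := ih
      have g1 := clos_int hr hS a (-round (z a)) z hz
      have hab := abs_sub_round (z a)
      rw [abs_le] at hab
      have key : ∃ v, Function.update z a v ∈ S ∧ 0 ≤ v ∧ v ≤ 1 / 2 := by
        rcases le_total 0 (z a - round (z a)) with hp | hp
        · exact ⟨_, g1, by push_cast; linarith, by push_cast; linarith⟩
        · have g2 := clos_neg hr hS a _ g1
          rw [Function.update_self, Function.update_idem] at g2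
          exact ⟨_, g2, by push_cast; linarith, by push_cast; linarith⟩
      obtain ⟨v, hv, hv0, hv1⟩ := key
      refine ⟨_, hv, ?_⟩
      intro m hm
      by_cases hma : m = a
      · subst hma; rw [Function.update_self]; exact ⟨hv0, hv1⟩
      · rw [Function.update_of_ne hma]
        exact h m ((Finset.mem_insert.1 hm).resolve_left hma)
  obtain ⟨z, hz, h⟩ := h1 Finset.univ
  refine ⟨z ∘ Tuple.sort (fun m => - z m), clos_perm hS _ z hz, ?_, ?_⟩
  · intro i j hij
    have := Tuple.monotone_sort (fun m => - z m) hij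
    simpa using this
  · intro m
    exact h _ (Finset.mem_univ _)

theorem orbit_clos (y : E r) : ∀ j ≤ r, ∀ z ∈ orbit r y, genF r j z ∈ orbit r y := by
  rintro j hj _ ⟨l, hl, rfl⟩
  refine ⟨j :: l, ?_, rfl⟩
  intro a ha
  rcases List.mem_cons.1 ha with rfl | h
  · exact hj
  · exact hl a h

theorem orbit_self (y : E r) : y ∈ orbit r y := ⟨[], by simp, rfl⟩

theorem gW_spec (hr : 2 ≤ r) (y : E r) :
    (∀ a ∈ gW r y, a ≤ r) ∧ wordAct r (gW r y).reverse y ∈ CplusCl r := by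
  have h : ∃ l : List ℕ, (∀ a ∈ l, a ≤ r) ∧ wordAct r l.reverse y ∈ CplusCl r ∧
      ∀ l' : List ℕ, (∀ a ∈ l', a ≤ r) → wordAct r l'.reverse y ∈ CplusCl r →
        l.length ≤ l'.length := by
    obtain ⟨c, ⟨l, hl, rfl⟩, hc⟩ := clos_alcove hr (orbit_clos y) ⟨y, orbit_self y⟩
    obtain ⟨l0, ⟨h0, h0'⟩, hm⟩ := (measure (List.length (α := ℕ))).wf.has_min
      {l : List ℕ | (∀ a ∈ l, a ≤ r) ∧ wordAct r l.reverse y ∈ CplusCl r}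
      ⟨l.reverse, by simpa using hl, by rw [List.reverse_reverse]; exact hc⟩
    exact ⟨l0, h0, h0', fun l' h1 h2 => not_lt.1 (hm l' ⟨h1, h2⟩)⟩
  unfold gW
  rw [dif_pos h]
  exact ⟨h.choose_spec.1, h.choose_spec.2.1⟩

theorem int_cases {a b : ℝ} {e n : ℤ} (he : e = 1 ∨ e = -1) (ha : 0 ≤ a) (ha' : a ≤ 1 / 2)
    (hb : 0 ≤ b) (hb' : b ≤ 1 / 2) (h : b = e * a + n) :
    a = b ∧ ((e = 1 ∧ n = 0) ∨ (e = -1 ∧ n = 0 ∧ a = 0) ∨ (e = -1 ∧ n = 1 ∧ a = 1 / 2)) := by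
  rcases he with rfl | rfl
  · push_cast at h
    have h1 : (n : ℝ) < 1 := by linarith
    have h2 : (-1 : ℝ) < n := by linarith
    have h3 : n = 0 := by
      have : n < 1 := by exact_mod_cast h1
      have : -1 < n := by exact_mod_cast h2
      omega
    subst h3
    push_cast at h
    exact ⟨by linarith, Or.inl ⟨rfl, rfl⟩⟩
  · push_cast at h
    have h1 : (n : ℝ) < 2 := by linarith
    have h2 : (-1 : ℝ) < n := by linarith
    have h3 : n = 0 ∨ n = 1 := by
      have : n < 2 := by exact_mod_cast h1
      have : -1 < n := by exact_mod_cast h2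
      omega
    rcases h3 with rfl | rfl
    · push_cast at h
      exact ⟨by linarith, Or.inr (Or.inl ⟨rfl, rfl, by linarith⟩)⟩
    · push_cast at h
      exact ⟨by linarith, Or.inr (Or.inr ⟨rfl, rfl, by linarith⟩)⟩

theorem alcove_unique (hr : 2 ≤ r) (c c' : E r) (hc : c ∈ CplusCl r) (hc' : c' ∈ CplusCl r)
    (l : List ℕ) (hl : ∀ a ∈ l, a ≤ r) (h : wordAct r l c = c') : c = c' := by
  obtain ⟨ε, σ, lam, h1, h2⟩ := word_aff hr l hl
  have h3 : c ∘ σ = c' := by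
    funext m
    have := h2 c m
    rw [h] at this
    exact (int_cases (h1 m) (hc.2 _).1 (hc.2 _).2 (hc'.2 _).1 (hc'.2 _).2 this).1
  have a1 : Monotone (fun m => -(c m)) := fun i j hij => neg_le_neg (hc.1 i j hij)
  have a2 : Monotone ((fun m => -(c m)) ∘ σ) := by
    intro i j hij
    have := hc'.1 i j hij
    rw [← h3] at this
    simpa using this
  have := Tuple.unique_monotone (f := fun m => -(c m)) (σ := σ) (τ := 1) a2 a1
  rw [← h3]
  funext m
  have := congrFun this m
  simp at this
  simp [this]

theorem cpt_spec (hr : 2 ≤ r) (O : Set (E r)) (hO : IsOrbit r O) :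
    cpt r O ∈ O ∧ cpt r O ∈ CplusCl r := by
  obtain ⟨y, rfl⟩ := hO
  have h : ∃ c, c ∈ orbit r y ∧ c ∈ CplusCl r := by
    obtain ⟨c, h1, h2⟩ := clos_alcove hr (orbit_clos y) ⟨y, orbit_self y⟩
    exact ⟨c, h1, h2⟩
  unfold cpt
  rw [dif_pos h]
  exact h.choose_spec

theorem gW_cpt (hr : 2 ≤ r) (O : Set (E r)) (hO : IsOrbit r O) (y : E r) (hy : y ∈ O) :
    wordAct r (gW r y) (cpt r O) = y := by
  obtain ⟨h1, h2⟩ := gW_spec hr y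
  obtain ⟨h3, h4⟩ := cpt_spec hr O hO
  obtain ⟨y0, hy0⟩ := hO
  have h5 : ∃ l : List ℕ, (∀ a ∈ l, a ≤ r) ∧
      wordAct r l (cpt r O) = wordAct r (gW r y).reverse y := by
    have h3' := h3
    rw [hy0] at h3' hy
    obtain ⟨l1, hl1, e1⟩ := h3'
    obtain ⟨l2, hl2, e2⟩ := hy
    refine ⟨(gW r y).reverse ++ (l2 ++ l1.reverse), ?_, ?_⟩
    · intro a ha
      simp only [List.mem_append, List.mem_reverse] at ha
      rcases ha with ha | ha | ha
      · exact h1 a ha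
      · exact hl2 a ha
      · exact hl1 a ha
    · rw [wordAct_append, wordAct_append]
      congr 1
      rw [← hy0] at e1
      have := word_rev hr l1.reverse (by simpa using hl1) y0
      rw [List.reverse_reverse, e1] at this
      rw [this, e2]
  obtain ⟨l, hl, e⟩ := h5
  have := alcove_unique hr _ _ h4 h2 l hl e
  rw [this]
  exact word_rev hr _ h1 y



/-! ### The function `ψ` describing the torus action -/

/-- `s = e * c_i + n` with a sign `e` and an integer `n`. -/
def RepS (c : E r) (s : ℝ) (e : ℤ) (i : Fin r) (n : ℤ) : Prop :=
  (e = 1 ∨ e = -1) ∧ s = e * c i + n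

/-- Values of `g t` in terms of the coordinate of `g c`. -/
def psiU (qh : Fˣ) (t : Fin r → Fˣ) (c : E r) (s : ℝ) : Fˣ :=
  if h : ∃ p : ℤ × Fin r × ℤ, RepS c s p.1 p.2.1 p.2.2 then
    (qh * qh) ^ h.choose.2.2 * t h.choose.2.1 ^ h.choose.1
  else qh ^ (⌈s - 1 / 2⌉ + ⌊s + 1 / 2⌋)

/-- compatibility of `t` with the point `c` of the closed alcove. -/
def Compat (qh : Fˣ) (t : Fin r → Fˣ) (c : E r) : Prop :=
  (∀ i, 0 ≤ c i ∧ c i ≤ 1 / 2) ∧ (∀ i j, c i = c j → t i = t j) ∧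
    (∀ i, c i = 0 → t i = 1) ∧ ∀ i, c i = 1 / 2 → t i = qh

theorem rep_wd {qh : Fˣ} {t : Fin r → Fˣ} {c : E r} (hC : Compat qh t c) {s : ℝ} {e e' : ℤ}
    {i i' : Fin r} {n n' : ℤ} (h : RepS c s e i n) (h' : RepS c s e' i' n') :
    (qh * qh) ^ n * t i ^ e = (qh * qh) ^ n' * t i' ^ e' := by
  obtain ⟨hb, h1, h2, h3⟩ := hC
  obtain ⟨he, hs⟩ := h
  obtain ⟨he', hs'⟩ := h'
  have hee : e' * e = 1 ∨ e' * e = -1 := by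
    rcases he with rfl | rfl <;> rcases he' with rfl | rfl <;> simp
  have key : c i' = ((e' * e : ℤ) : ℝ) * c i + ((e' * (n - n') : ℤ) : ℝ) := by
    push_cast
    rcases he' with rfl | rfl
    · push_cast at hs' ⊢; linarith
    · push_cast at hs' ⊢; linarith
  obtain ⟨hc, hh⟩ := int_cases hee (hb i).1 (hb i).2 (hb i').1 (hb i').2 key
  rw [← h1 i i' hc]
  rcases hh with ⟨g1, g2⟩ | ⟨g1, g2, g3⟩ | ⟨g1, g2, g3⟩
  · rcases he with rfl | rfl <;> rcases he' with rfl | rfl <;> simp at g1 g2 <;>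
      · have : n = n' := by omega
        subst this; rfl
  · rw [h2 i g3]
    have : n = n' := by rcases he' with rfl | rfl <;> simp at g2 <;> omega
    subst this; simp
  · rw [h3 i g3]
    rcases he with rfl | rfl <;> rcases he' with rfl | rfl <;> simp at g1 g2
    · have : n' = n + 1 := by omega
      subst this; rw [zpow_add]; simp [mul_assoc]
    · have : n = n' + 1 := by omega
      subst this; rw [zpow_add]; simp [mul_assoc]

theorem psi_rep {qh : Fˣ} {t : Fin r → Fˣ} {c : E r} (hC : Compat qh t c) {s : ℝ} {e : ℤ}
    {i : Fin r} {n : ℤ} (h : RepS c s e i n) :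
    psiU qh t c s = (qh * qh) ^ n * t i ^ e := by
  have hx : ∃ p : ℤ × Fin r × ℤ, RepS c s p.1 p.2.1 p.2.2 := ⟨(e, i, n), h⟩
  unfold psiU
  rw [dif_pos hx]
  exact rep_wd hC hx.choose_spec h

theorem rep_add {c : E r} {s : ℝ} {e : ℤ} {i : Fin r} {n : ℤ} (h : RepS c s e i n) (a : ℤ) :
    RepS c (s + a) e i (n + a) := by
  refine ⟨h.1, ?_⟩
  rw [h.2]; push_cast; ring

theorem rep_neg {c : E r} {s : ℝ} {e : ℤ} {i : Fin r} {n : ℤ} (h : RepS c s e i n) :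
    RepS c (-s) (-e) i (-n) := by
  refine ⟨?_, ?_⟩
  · rcases h.1 with h | h <;> simp [h]
  · rw [h.2]; push_cast; ring

theorem psi_add {qh : Fˣ} {t : Fin r → Fˣ} {c : E r} (hC : Compat qh t c) (s : ℝ) :
    psiU qh t c (s + 1) = qh * qh * psiU qh t c s := by
  by_cases hx : ∃ p : ℤ × Fin r × ℤ, RepS c s p.1 p.2.1 p.2.2
  · obtain ⟨⟨e, i, n⟩, h⟩ := hx
    have h' := rep_add h 1
    push_cast at h'
    rw [psi_rep hC h, psi_rep hC h', zpow_add, zpow_one]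
    simp only [mul_assoc, mul_comm, mul_left_comm]
  · have hx' : ¬ ∃ p : ℤ × Fin r × ℤ, RepS c (s + 1) p.1 p.2.1 p.2.2 := by
      rintro ⟨⟨e, i, n⟩, h⟩
      apply hx
      have h' := rep_add h (-1)
      push_cast at h'
      rw [add_neg_cancel_right] at h'
      exact ⟨(e, i, _), h'⟩
    unfold psiU
    rw [dif_neg hx, dif_neg hx']
    have e1 : s + 1 - 1 / 2 = (s - 1 / 2) + 1 := by ring
    have e2 : s + 1 + 1 / 2 = (s + 1 / 2) + 1 := by ring
    rw [e1, e2, Int.ceil_add_one, Int.floor_add_one]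
    have e3 : ⌈s - 1 / 2⌉ + 1 + (⌊s + 1 / 2⌋ + 1) = 1 + 1 + (⌈s - 1 / 2⌉ + ⌊s + 1 / 2⌋) := by ring
    rw [e3, zpow_add qh (1 + 1), zpow_add qh 1 1, zpow_one]

theorem psi_neg {qh : Fˣ} {t : Fin r → Fˣ} {c : E r} (hC : Compat qh t c) (s : ℝ) :
    psiU qh t c (-s) = (psiU qh t c s)⁻¹ := by
  by_cases hx : ∃ p : ℤ × Fin r × ℤ, RepS c s p.1 p.2.1 p.2.2
  · obtain ⟨⟨e, i, n⟩, h⟩ := hx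
    rw [psi_rep hC h, psi_rep hC (rep_neg h), mul_inv, zpow_neg, zpow_neg]
  · have hx' : ¬ ∃ p : ℤ × Fin r × ℤ, RepS c (-s) p.1 p.2.1 p.2.2 := by
      rintro ⟨⟨e, i, n⟩, h⟩
      apply hx
      have h' := rep_neg h
      rw [neg_neg] at h'
      exact ⟨(-e, i, -n), h'⟩
    unfold psiU
    rw [dif_neg hx, dif_neg hx', ← zpow_neg]
    have e1 : -s - 1 / 2 = -(s + 1 / 2) := by ring
    have e2 : -s + 1 / 2 = -(s - 1 / 2) := by ring
    rw [e1, e2, Int.ceil_neg, Int.floor_neg]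
    congr 1; ring

theorem psi_zero {qh : Fˣ} {t : Fin r → Fˣ} {c : E r} (hC : Compat qh t c) :
    psiU qh t c 0 = 1 := by
  by_cases hx : ∃ p : ℤ × Fin r × ℤ, RepS c 0 p.1 p.2.1 p.2.2
  · obtain ⟨⟨e, i, n⟩, h⟩ := hx
    rw [psi_rep hC h]
    obtain ⟨g1, g2⟩ := int_cases h.1 (hC.1 i).1 (hC.1 i).2 le_rfl (by norm_num) h.2
    rw [hC.2.2.1 i g1]
    rcases g2 with ⟨-, g⟩ | ⟨-, g, -⟩ | ⟨-, -, g⟩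
    · simp only at g; simp [g]
    · simp only at g; simp [g]
    · rw [g1] at g; norm_num at g
  · unfold psiU
    rw [dif_neg hx]
    have e1 : ⌈(0 : ℝ) - 1 / 2⌉ = 0 := by rw [Int.ceil_eq_iff]; norm_num
    have e2 : ⌊(0 : ℝ) + 1 / 2⌋ = 0 := by rw [Int.floor_eq_iff]; norm_num
    rw [e1, e2]; simp

theorem psi_half {qh : Fˣ} {t : Fin r → Fˣ} {c : E r} (hC : Compat qh t c) :
    psiU qh t c (1 / 2) = qh := by
  by_cases hx : ∃ p : ℤ × Fin r × ℤ, RepS c (1 / 2) p.1 p.2.1 p.2.2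
  · obtain ⟨⟨e, i, n⟩, h⟩ := hx
    rw [psi_rep hC h]
    obtain ⟨g1, g2⟩ := int_cases h.1 (hC.1 i).1 (hC.1 i).2 (by norm_num) le_rfl h.2
    rw [hC.2.2.2 i g1]
    rcases g2 with ⟨g', g⟩ | ⟨-, g, g''⟩ | ⟨g', g, -⟩
    · simp only at g g'; simp [g, g']
    · rw [g1] at g''; norm_num at g''
    · simp only at g g'; simp [g, g']
  · unfold psiU
    rw [dif_neg hx]
    have e1 : ⌈(1 / 2 : ℝ) - 1 / 2⌉ = 0 := by rw [Int.ceil_eq_iff]; norm_num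
    have e2 : ⌊(1 / 2 : ℝ) + 1 / 2⌋ = 1 := by rw [Int.floor_eq_iff]; norm_num
    rw [e1, e2]; simp

/-! ### The torus -/

theorem tcU_succ (t : Fin r → Fˣ) (n : Fin r) : tcU F r t ((n : ℕ) + 1) = t n := by
  unfold tcU
  rw [Finset.prod_eq_single n]
  · simp
  · intro b _ hb
    rw [if_neg]
    intro h
    apply hb
    apply Fin.ext
    omega
  · intro h; exact absurd (Finset.mem_univ _) h

theorem torusAct_aff (qh : Fˣ) (g : E r → E r) (t : Fin r → Fˣ) (ε : Fin r → ℤ)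
    (σ : Equiv.Perm (Fin r)) (lam : Fin r → ℤ) (h : IsAff g ε σ lam) (m : Fin r) :
    torusAct F r qh g t m = (qh * qh) ^ lam m * t (σ m) ^ ε m := by
  unfold torusAct
  have e0 : g 0 m = lam m := by rw [h.2]; simp
  rw [e0, Int.floor_intCast]
  congr 1
  rw [Finset.prod_eq_single (σ m)]
  · rw [Pi.sub_apply, e0, h.2, eV_self]
    congr 1
    have : ((ε m : ℝ) * 1 + lam m - lam m) = (ε m : ℝ) := by ring
    rw [this, Int.floor_intCast]
  · intro b _ hb
    rw [Pi.sub_apply, e0, h.2, eV_ne hb.symm]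
    simp
  · intro h; exact absurd (Finset.mem_univ _) h

theorem compat_of_TO (hr : 2 ≤ r) (qh : Fˣ) (O : Set (E r)) (hO : IsOrbit r O)
    (t : Fin r → Fˣ) (ht : t ∈ TOset F r qh O) : Compat qh t (cpt r O) := by
  obtain ⟨-, hc⟩ := cpt_spec hr O hO
  set c := cpt r O with hcdef
  have step : ∀ i j : Fin r, (j : ℕ) = i + 1 → c i = c j → t i = t j := by
    intro i j hj hij
    have := ht (i + 1) (by have := j.2; omega)
    rw [alphaF, tpowCo, if_neg (by omega), if_neg (by have := j.2; omega), if_neg (by omega),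
      if_neg (by have := j.2; omega)] at this
    have ej : (i : ℕ) + 1 + 1 = (j : ℕ) + 1 := by omega
    rw [ej, cd_succ, cd_succ, tcU_succ, tcU_succ] at this
    exact mul_inv_eq_one.1 (this (sub_eq_zero.2 hij))
  have chain : ∀ d : ℕ, ∀ i j : Fin r, (j : ℕ) = i + d → c i = c j → t i = t j := by
    intro d
    induction d with
    | zero => intro i j hj _; congr 1; exact Fin.ext (by omega)
    | succ d ih =>
      intro i j hj hij
      have hm : (i : ℕ) + d < r := by have := j.2; omega
      set m : Fin r := ⟨i + d, hm⟩ with hmd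
      have h1 := hc.1 i m (by rw [Fin.le_def, hmd]; simp)
      have h2 := hc.1 m j (by rw [Fin.le_def, hmd]; simp; omega)
      rw [ih i m rfl (by linarith), step m j (by rw [hmd]; simp; omega) (by linarith)]
  have eqq : ∀ i j : Fin r, c i = c j → t i = t j := by
    intro i j hij
    rcases le_total (i : ℕ) j with h | h
    · exact chain (j - i) i j (by omega) hij
    · exact (chain (i - j) j i (by omega) hij.symm).symm
  refine ⟨hc.2, eqq, ?_, ?_⟩
  · intro i hi
    set n : Fin r := ⟨r - 1, by omega⟩ with hn
    have hle := hc.1 i n (by rw [Fin.le_def, hn]; simp; have := i.2; omega)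
    have hn0 : c n = 0 := le_antisymm (by linarith) (hc.2 n).1
    have := ht r le_rfl
    have er : r = (n : ℕ) + 1 := by rw [hn]; simp; omega
    rw [alphaF, tpowCo, if_neg (by omega), if_pos rfl, if_neg (by omega), if_pos rfl] at this
    have e1 : cd r (cpt r O) r = c n := by
      have := cd_succ (cpt r O) n
      rwa [← er] at this
    have e2 : tcU F r t r = t n := by
      have := tcU_succ t n
      rwa [← er] at this
    rw [e1, e2] at this
    rw [eqq i n (by rw [hi, hn0])]
    exact this (by rw [hn0]; simp)
  · intro i hi
    set n : Fin r := ⟨0, by omega⟩ with hn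
    have hle := hc.1 n i (by rw [Fin.le_def, hn]; simp)
    have hn0 : c n = 1 / 2 := le_antisymm (hc.2 n).2 (by linarith)
    have := ht 0 (by omega)
    rw [alphaF, tpowCo, if_pos rfl, if_pos rfl] at this
    have e1 : cd r (cpt r O) 1 = c n := cd_succ (cpt r O) n
    have e2 : tcU F r t 1 = t n := tcU_succ t n
    rw [e1, e2] at this
    rw [eqq i n (by rw [hi, hn0])]
    exact (mul_inv_eq_one.1 (this (by rw [hn0]; norm_num))).symm

theorem torus_psi (hr : 2 ≤ r) (qh : Fˣ) (O : Set (E r)) (hO : IsOrbit r O)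
    (t : Fin r → Fˣ) (ht : t ∈ TOset F r qh O) (n : Fin r) (hn : (n : ℕ) = 0) (y : E r)
    (hy : y ∈ O) :
    tcU F r (torusAct F r qh (gfun r y) t) 1 = psiU qh t (cpt r O) (y n) := by
  obtain ⟨ε, σ, lam, h⟩ := word_aff hr (gW r y) (gW_spec hr y).1
  have e1 : tcU F r (torusAct F r qh (gfun r y) t) 1 = torusAct F r qh (gfun r y) t n := by
    have := tcU_succ (torusAct F r qh (gfun r y) t) n
    rwa [hn] at this
  have h' : IsAff (gfun r y) ε σ lam := h
  rw [e1, torusAct_aff qh _ t ε σ lam h']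
  symm
  apply psi_rep (compat_of_TO hr qh O hO t ht)
  refine ⟨h.1 n, ?_⟩
  rw [← h.2, gW_cpt hr O hO y hy]



/-! ### Conclusion -/

/-- `T` and `S` agree on `K`, and `S` preserves `K`. -/
def Agr (K : Submodule F (QA F r)) (T S : Module.End F (QA F r)) : Prop :=
  ∀ f ∈ K, T f = S f ∧ S f ∈ K

theorem Agr.mul {K : Submodule F (QA F r)} {T S T' S' : Module.End F (QA F r)} (h : Agr K T S)
    (h' : Agr K T' S') : Agr K (T * T') (S * S') := by
  intro f hf
  obtain ⟨e1, e2⟩ := h' f hf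
  obtain ⟨e3, e4⟩ := h _ e2
  refine ⟨?_, e4⟩
  rw [Module.End.mul_apply, Module.End.mul_apply, e1, e3]

theorem Agr.add_smul {K : Submodule F (QA F r)} {T S : Module.End F (QA F r)} (h : Agr K T S)
    (c : F) : Agr K (T + c • 1) (S + c • 1) := by
  intro f hf
  obtain ⟨e1, e2⟩ := h f hf
  refine ⟨?_, ?_⟩
  · simp [e1]
  · simpa using K.add_mem e2 (K.smul_mem c hf)

theorem Agr.sub_smul {K : Submodule F (QA F r)} {T S : Module.End F (QA F r)} (h : Agr K T S)
    (c : F) : Agr K (T - c • 1) (S - c • 1) := by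
  intro f hf
  obtain ⟨e1, e2⟩ := h f hf
  refine ⟨?_, ?_⟩
  · simp [e1]
  · simpa using K.sub_mem e2 (K.smul_mem c hf)

theorem Agr.fin {K : Submodule F (QA F r)} {T S T' S' : Module.End F (QA F r)} (h : Agr K T S)
    (h' : Agr K T' S') (e : S = S') : ∀ f ∈ K, T f = T' f := by
  intro f hf
  rw [(h f hf).1, (h' f hf).1, e]

theorem Agr.fin0 {K : Submodule F (QA F r)} {T S : Module.End F (QA F r)} (h : Agr K T S)
    (e : S = 0) : ∀ f ∈ K, T f = 0 := by
  intro f hf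
  rw [(h f hf).1, e]; rfl

theorem upd_add (y : E r) (m : Fin r) : eV r m + y = Function.update y m (y m + 1) := by
  funext n
  by_cases h : n = m
  · subst h; simp [eV_self, add_comm]
  · simp [eV_ne h, h]

theorem upd_sub (y : E r) (m : Fin r) : -eV r m + y = Function.update y m (y m - 1) := by
  funext n
  by_cases h : n = m
  · subst h; simp [eV_self]; ring
  · simp [eV_ne h, h]

theorem upd_neg (y : E r) (m : Fin r) : y - (2 * y m) • eV r m = Function.update y m (-y m) := by
  funext n
  by_cases h : n = m
  · subst h; simp [eV_self]; ring
  · simp [eV_ne h, h]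

theorem orb_add (hr : 2 ≤ r) {O : Set (E r)} (hO : IsOrbit r O) (m : Fin r) :
    ∀ y ∈ O, eV r m + y ∈ O := by
  obtain ⟨y0, rfl⟩ := hO
  intro y hy
  rw [upd_add]; exact clos_add hr (orbit_clos y0) m y hy

theorem orb_sub (hr : 2 ≤ r) {O : Set (E r)} (hO : IsOrbit r O) (m : Fin r) :
    ∀ y ∈ O, -eV r m + y ∈ O := by
  obtain ⟨y0, rfl⟩ := hO
  intro y hy
  rw [upd_sub]; exact clos_sub hr (orbit_clos y0) m y hy

theorem orb_neg (hr : 2 ≤ r) {O : Set (E r)} (hO : IsOrbit r O) (m : Fin r) :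
    ∀ y ∈ O, y - (2 * y m) • eV r m ∈ O := by
  obtain ⟨y0, rfl⟩ := hO
  intro y hy
  rw [upd_neg]; exact clos_neg hr (orbit_clos y0) m y hy

theorem agr_A (hr : 2 ≤ r) {O : Set (E r)} (hO : IsOrbit r O) (qh : Fˣ) (k0 u0 k kr ur : F)
    (t : Fin r → Fˣ) (i j : Fin r) (hj : (j : ℕ) = i + 1) :
    Agr (FO F r O) (Tfull F r qh k0 u0 k kr ur t (i + 1))
      (Aop F r (pr i - pr j) (eV r i - eV r j) k) := by
  intro f hf
  refine ⟨?_, ?_⟩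
  · rw [Tfull, if_neg (by omega), Top_A k kr ur i j hj]
  · refine Aop_FO _ _ _ ?_ ?_ ?_ f hf
    · intro y hy
      obtain ⟨y0, rfl⟩ := hO
      have := orbit_clos y0 (i + 1) (by have := i.2; omega) y hy
      rw [genF, if_neg (by omega), sW_A i j hj] at this
      exact this
    · intro y hy
      have := orb_add hr hO i _ (orb_sub hr hO j y hy)
      rwa [← add_assoc, ← sub_eq_add_neg] at this
    · intro y hy
      have := orb_sub hr hO i _ (orb_add hr hO j y hy)
      rw [← add_assoc] at this
      convert this using 2
      abel

theorem agr_B (hr : 2 ≤ r) {O : Set (E r)} (hO : IsOrbit r O) (qh : Fˣ) (k0 u0 k kr ur : F)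
    (t : Fin r → Fˣ) (n : Fin r) (hn : (n : ℕ) + 1 = r) :
    Agr (FO F r O) (Tfull F r qh k0 u0 k kr ur t r)
      (Bop F r (pr n) (eV r n) 1 kr ur (fun _ => 1)) := by
  intro f hf
  refine ⟨?_, ?_⟩
  · rw [Tfull, if_neg (by omega), Top_B k kr ur n hn]
  · exact Bop_FO _ _ _ _ _ _ (orb_neg hr hO n) (orb_add hr hO n) (orb_sub hr hO n) f hf

theorem agr_0 (hr : 2 ≤ r) {O : Set (E r)} (hO : IsOrbit r O) (qh : Fˣ) (k0 u0 k kr ur : F)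
    (t : Fin r → Fˣ) (ht : t ∈ TOset F r qh O) (n : Fin r) (hn : (n : ℕ) = 0) :
    Agr (FO F r O) (Tfull F r qh k0 u0 k kr ur t 0)
      (Bop F r (-pr n) (-eV r n) qh k0 u0 (fun s => ((psiU qh t (cpt r O) (-s) : Fˣ) : F))) := by
  intro f hf
  refine ⟨?_, ?_⟩
  · rw [Tfull, if_pos rfl]
    refine FO_eq _ _ ?_ f hf
    intro y hy
    exact T0_eq qh k0 u0 t (fun s => ((psiU qh t (cpt r O) s : Fˣ) : F)) n hn y
      (by rw [torus_psi hr qh O hO t ht n hn y hy])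
  · refine Bop_FO _ _ _ _ _ _ ?_ (orb_sub hr hO n) ?_ f hf
    · intro y hy
      have := orb_neg hr hO n y hy
      convert this using 2
      simp [pr_apply]
    · intro y hy
      rw [neg_neg]; exact orb_add hr hO n y hy

theorem main_aux (hr : 2 ≤ r)
    (qh k0 u0 k kr ur : Fˣ) (O : Set (E r)) (hO : IsOrbit r O)
    (t : Fin r → Fˣ) (ht : t ∈ TOset F r qh O) (T : ℕ → Module.End F (QA F r))
    (hT : T = Tfull F r qh (k0 : F) (u0 : F) (k : F) (kr : F) (ur : F) t) :
    (∀ i : ℕ, 1 ≤ i → i + 2 ≤ r → ∀ f ∈ FO F r O,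
      (T i * T (i + 1) * T i) f = (T (i + 1) * T i * T (i + 1)) f) ∧
    (∀ f ∈ FO F r O,
      (T (r - 1) * T r * T (r - 1) * T r) f = (T r * T (r - 1) * T r * T (r - 1)) f) ∧
    (∀ i i' : ℕ, 1 ≤ i → i ≤ r → 1 ≤ i' → i' ≤ r → (i + 1 < i' ∨ i' + 1 < i) →
      ∀ f ∈ FO F r O, (T i * T i') f = (T i' * T i) f) ∧
    (∀ f ∈ FO F r O, (T 0 * T 1 * T 0 * T 1) f = (T 1 * T 0 * T 1 * T 0) f) ∧
    (∀ i : ℕ, 1 < i → i ≤ r → ∀ f ∈ FO F r O, (T 0 * T i) f = (T i * T 0) f) ∧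
    (∀ f ∈ FO F r O, ((T 0 - (k0 : F) • 1) * (T 0 + ((k0 : F))⁻¹ • 1)) f = 0) ∧
    (∀ i : ℕ, 1 ≤ i → i < r → ∀ f ∈ FO F r O,
      ((T i - (k : F) • 1) * (T i + ((k : F))⁻¹ • 1)) f = 0) ∧
    (∀ f ∈ FO F r O, ((T r - (kr : F) • 1) * (T r + ((kr : F))⁻¹ • 1)) f = 0) := by
  have hA : ∀ (i : ℕ) (a b : Fin r), (b : ℕ) = a + 1 → i = a + 1 →
      Agr (FO F r O) (T i) (Aop F r (pr a - pr b) (eV r a - eV r b) (k : F)) := by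
    intro i a b hb hi
    rw [hT, hi]; exact agr_A hr hO qh k0 u0 k kr ur t a b hb
  have hB : ∀ (n : Fin r), (n : ℕ) + 1 = r →
      Agr (FO F r O) (T r) (Bop F r (pr n) (eV r n) 1 (kr : F) ur (fun _ => 1)) := by
    intro n hn
    rw [hT]; exact agr_B hr hO qh k0 u0 k kr ur t n hn
  set ψ : ℝ → F := fun s => ((psiU qh t (cpt r O) (-s) : Fˣ) : F) with hψdef
  have h0 : ∀ (n : Fin r), (n : ℕ) = 0 →
      Agr (FO F r O) (T 0) (Bop F r (-pr n) (-eV r n) (qh : F) k0 u0 ψ) := by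
    intro n hn
    rw [hT]; exact agr_0 hr hO qh k0 u0 k kr ur t ht n hn
  have hC := compat_of_TO hr qh O hO t ht
  have p1 : ∀ s, ψ (s + 1) = (qh : F)⁻¹ * (qh : F)⁻¹ * ψ s := by
    intro s
    have h := psi_add hC (-(s + 1))
    rw [show -(s + 1) + 1 = -s by ring] at h
    simp only [hψdef]
    rw [h]
    push_cast
    have := qh.ne_zero
    field_simp
  have p2 : ∀ s, ψ (-s) * ψ s = 1 := by
    intro s
    simp only [hψdef]
    rw [psi_neg hC (-s)]
    simp
  have p3 : ψ 0 = 1 := by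
    simp only [hψdef]
    rw [neg_zero, psi_zero hC]; simp
  have p4 : ψ (1 / 2) = (qh : F)⁻¹ := by
    simp only [hψdef]
    rw [psi_neg hC, psi_half hC]; simp
  have z : ∀ {m n : Fin r}, (n : ℕ) ≠ m → pr n (eV r m) = 0 := by
    intro m n h
    exact pr_ne (fun h' => h (by rw [h']))
  have hAx : ∀ i : ℕ, 1 ≤ i → i < r → ∃ a b : Fin r, (b : ℕ) = a + 1 ∧ i = a + 1 := by
    intro i h1 h2
    exact ⟨⟨i - 1, by omega⟩, ⟨i, h2⟩, by simp; omega, by simp; omega⟩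
  have hlast : ∃ n : Fin r, (n : ℕ) + 1 = r := ⟨⟨r - 1, by omega⟩, by simp; omega⟩
  obtain ⟨nl, hnl⟩ := hlast
  have hzero : ∃ n : Fin r, (n : ℕ) = 0 := ⟨⟨0, by omega⟩, rfl⟩
  obtain ⟨n0, hn0⟩ := hzero
  refine ⟨?_, ?_, ?_, ?_, ?_, ?_, ?_, ?_⟩
  · intro i h1 h2
    obtain ⟨a, b, hb, hi⟩ := hAx i h1 (by omega)
    obtain ⟨b', c, hc, hi'⟩ := hAx (i + 1) (by omega) (by omega)
    have : b' = b := Fin.ext (by omega)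
    subst this
    have A1 := hA i a b' hb hi
    have A2 := hA (i + 1) b' c hc hi'
    refine ((A1.mul A2).mul A1).fin ((A2.mul A1).mul A2) ?_
    exact A2_braid _ _ _ _ _ _ _ k.ne_zero (pr_self _) (z (by omega)) (z (by omega))
      (z (by omega)) (pr_self _) (z (by omega)) (z (by omega)) (z (by omega)) (pr_self _)
  · obtain ⟨a, b, hb, hi⟩ := hAx (r - 1) (by omega) (by omega)
    have : b = nl := Fin.ext (by omega)
    subst this
    have A1 := hA (r - 1) a b hb hi
    have A2 := hB b hnl
    refine (((A1.mul A2).mul A1).mul A2).fin (((A2.mul A1).mul A2).mul A1) ?_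
    exact BC2_braid _ _ _ _ _ _ _ _ _ one_ne_zero k.ne_zero kr.ne_zero ur.ne_zero
      (pr_self _) (z (by omega)) (z (by omega)) (pr_self _) (by simp) (by simp) rfl (by simp)
  · have main : ∀ i i' : ℕ, 1 ≤ i → i ≤ r → 1 ≤ i' → i' ≤ r → i + 1 < i' →
        ∀ f ∈ FO F r O, (T i * T i') f = (T i' * T i) f := by
      intro i i' h1 h2 h3 h4 h5
      obtain ⟨a, b, hb, hi⟩ := hAx i h1 (by omega)
      have A1 := hA i a b hb hi
      by_cases h6 : i' = r
      · have A2 := hB nl hnl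
        rw [h6]
        refine (A1.mul A2).fin (A2.mul A1) ?_
        refine Rk1_comm (Aop_Rk1 _ _ _) (Bop_Rk1 _ _ _ _ _ _ one_ne_zero) ?_ ?_
        · rw [LinearMap.sub_apply, z (by omega), z (by omega), sub_zero]
        · rw [map_sub, z (by omega), z (by omega), sub_zero]
      · obtain ⟨a', b', hb', hi'⟩ := hAx i' h3 (by omega)
        have A2 := hA i' a' b' hb' hi'
        refine (A1.mul A2).fin (A2.mul A1) ?_
        refine Rk1_comm (Aop_Rk1 _ _ _) (Aop_Rk1 _ _ _) ?_ ?_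
        · simp only [LinearMap.sub_apply, map_sub]
          rw [z (by omega), z (by omega), z (by omega), z (by omega)]; simp
        · simp only [LinearMap.sub_apply, map_sub]
          rw [z (by omega), z (by omega), z (by omega), z (by omega)]; simp
    intro i i' h1 h2 h3 h4 h5 f hf
    rcases h5 with h5 | h5
    · exact main i i' h1 h2 h3 h4 h5 f hf
    · exact (main i' i h3 h4 h1 h2 h5 f hf).symm
  · obtain ⟨a, b, hb, hi⟩ := hAx 1 le_rfl (by omega)
    have : a = n0 := Fin.ext (by omega)
    subst this
    have A1 := hA 1 a b hb hi
    have A2 := h0 a hn0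
    refine (((A2.mul A1).mul A2).mul A1).fin (((A1.mul A2).mul A1).mul A2) ?_
    have := BC2_braid (-pr b) (-pr a) (-eV r b) (-eV r a) (k : F) (qh : F) (k0 : F) (u0 : F) ψ
      qh.ne_zero k.ne_zero k0.ne_zero u0.ne_zero (by simp [pr_self])
      (by simp [z (m := a) (n := b) (by omega)]) (by simp [z (m := b) (n := a) (by omega)])
      (by simp [pr_self]) p1 p2 p3 p4
    rw [neg_sub_neg, neg_sub_neg] at this
    exact this.symm
  · intro i h1 h2
    have A1 := h0 n0 hn0
    by_cases h6 : i = r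
    · have A2 := hB nl hnl
      rw [h6]
      refine (A1.mul A2).fin (A2.mul A1) ?_
      refine Rk1_comm (Bop_Rk1 _ _ _ _ _ _ qh.ne_zero) (Bop_Rk1 _ _ _ _ _ _ one_ne_zero) ?_ ?_
      · rw [LinearMap.neg_apply, z (by omega), neg_zero]
      · rw [map_neg, z (by omega), neg_zero]
    · obtain ⟨a, b, hb, hi⟩ := hAx i (by omega) (by omega)
      have A2 := hA i a b hb hi
      refine (A1.mul A2).fin (A2.mul A1) ?_
      refine Rk1_comm (Bop_Rk1 _ _ _ _ _ _ qh.ne_zero) (Aop_Rk1 _ _ _) ?_ ?_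
      · rw [LinearMap.neg_apply, map_sub, z (by omega), z (by omega)]; simp
      · rw [map_neg, LinearMap.sub_apply, z (by omega), z (by omega)]; simp
  · have A1 := h0 n0 hn0
    refine ((A1.sub_smul _).mul (A1.add_smul _)).fin0 ?_
    exact hecke_of_quad _ _ k0.ne_zero (Bop_quad _ _ _ _ _ _ qh.ne_zero k0.ne_zero u0.ne_zero
      (by simp [pr_self]) p1 p2 p3 p4)
  · intro i h1 h2
    obtain ⟨a, b, hb, hi⟩ := hAx i h1 h2
    have A1 := hA i a b hb hi
    refine ((A1.sub_smul _).mul (A1.add_smul _)).fin0 ?_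
    refine hecke_of_quad _ _ k.ne_zero (Aop_quad _ _ _ k.ne_zero ?_ (eV r a) ?_)
    · simp only [LinearMap.sub_apply, map_sub]
      rw [pr_self, pr_self, z (by omega), z (by omega)]; norm_num
    · rw [LinearMap.sub_apply, pr_self, z (by omega), sub_zero]
  · have A1 := hB nl hnl
    refine ((A1.sub_smul _).mul (A1.add_smul _)).fin0 ?_
    exact hecke_of_quad _ _ kr.ne_zero (Bop_quad _ _ _ _ _ _ one_ne_zero kr.ne_zero ur.ne_zero
      (pr_self _) (by simp) (by simp) rfl (by simp))

/-- For a `W`-orbit `𝒪` and `t ∈ T_𝒪`, the operators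
`T₀^𝒪, T₁^𝒪, …, T_r^𝒪` on `F[𝒪]` satisfy the affine type `C_r` braid relations and the
quadratic Hecke relations. -/
theorem statement3 (F : Type*) [Field F] [CharZero F] (r : ℕ) (hr : 2 ≤ r)
    (qh k0 u0 k kr ur : Fˣ) (O : Set (E r)) (hO : IsOrbit r O)
    (t : Fin r → Fˣ) (ht : t ∈ TOset F r qh O) :
    letI T : ℕ → Module.End F (QA F r) :=
      Tfull F r qh (k0 : F) (u0 : F) (k : F) (kr : F) (ur : F) t
    (∀ i : ℕ, 1 ≤ i → i + 2 ≤ r → ∀ f ∈ FO F r O,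
      (T i * T (i + 1) * T i) f = (T (i + 1) * T i * T (i + 1)) f) ∧
    (∀ f ∈ FO F r O,
      (T (r - 1) * T r * T (r - 1) * T r) f = (T r * T (r - 1) * T r * T (r - 1)) f) ∧
    (∀ i i' : ℕ, 1 ≤ i → i ≤ r → 1 ≤ i' → i' ≤ r → (i + 1 < i' ∨ i' + 1 < i) →
      ∀ f ∈ FO F r O, (T i * T i') f = (T i' * T i) f) ∧
    (∀ f ∈ FO F r O, (T 0 * T 1 * T 0 * T 1) f = (T 1 * T 0 * T 1 * T 0) f) ∧
    (∀ i : ℕ, 1 < i → i ≤ r → ∀ f ∈ FO F r O, (T 0 * T i) f = (T i * T 0) f) ∧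
    (∀ f ∈ FO F r O, ((T 0 - (k0 : F) • 1) * (T 0 + ((k0 : F))⁻¹ • 1)) f = 0) ∧
    (∀ i : ℕ, 1 ≤ i → i < r → ∀ f ∈ FO F r O,
      ((T i - (k : F) • 1) * (T i + ((k : F))⁻¹ • 1)) f = 0) ∧
    (∀ f ∈ FO F r O, ((T r - (kr : F) • 1) * (T r + ((kr : F))⁻¹ • 1)) f = 0) := by
  exact main_aux hr qh k0 u0 k kr ur O hO t ht _ rfl

end QP

end
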